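/- Let m, n ≥ 2 and r, s ≥ 1 be integers. The commutator subgroups G⁺_{m,r} and G⁺_{n,s} of the Higman–Thompson groups G_{m,r} and G_{n,s} are isomorphic as groups if and only if m = n and gcd(m−1, r) = gcd(n−1, s). -/

import Mathlib

/-- A point `x_i α` of `X_r W_n`: the letter `x_i` together with a word `α` over `{1,…,n}`. -/
abbrev HTPt (n r : ℕ) := Fin r × List (Fin n)

/-- The right action of the free monoid `W_n` on `X_r W_n`: `(x_i α) · w = x_i (α w)`. -/
def HTact {n r : ℕ} (u : HTPt n r) (w : List (Fin n)) : HTPt n r := (u.1, u.2 ++ w)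

/-- A subspace of `X_r W_n`: a nonempty subset closed under the right `W_n`-action. -/
def IsSubspace {n r : ℕ} (V : Set (HTPt n r)) : Prop :=
  V.Nonempty ∧ ∀ u ∈ V, ∀ w : List (Fin n), HTact u w ∈ V

/-- A cofinite subset of `X_r W_n`. -/
def IsCofinite {n r : ℕ} (V : Set (HTPt n r)) : Prop := Set.Finite Vᶜ

/-- A cofinite isomorphism of `X_r W_n`: a bijective homomorphism (partial map commuting with
the right `W_n`-action) between cofinite subspaces. -/
def IsCofIso {n r : ℕ} (θ : HTPt n r →. HTPt n r) : Prop :=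
  IsSubspace θ.Dom ∧ IsCofinite θ.Dom ∧ IsSubspace θ.ran ∧ IsCofinite θ.ran ∧
    (∀ u v, v ∈ θ u → ∀ w : List (Fin n), HTact v w ∈ θ (HTact u w)) ∧
    (∀ u₁ u₂ v, v ∈ θ u₁ → v ∈ θ u₂ → u₁ = u₂)

/-- `θ'` extends `θ`: `θ' u = θ u` whenever `θ u` is defined. -/
def HTExtends {n r : ℕ} (θ' θ : HTPt n r →. HTPt n r) : Prop :=
  ∀ u v, v ∈ θ u → v ∈ θ' u

/-- A maximal cofinite isomorphism: its only extension is itself. -/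
def IsMaxCofIso {n r : ℕ} (θ : HTPt n r →. HTPt n r) : Prop :=
  IsCofIso θ ∧ ∀ θ', IsCofIso θ' → HTExtends θ' θ → θ' = θ

/-- The underlying set of the Higman–Thompson group `G_{n,r}`: the maximal cofinite
isomorphisms of `X_r W_n`. -/
abbrev HT (n r : ℕ) := {θ : HTPt n r →. HTPt n r // IsMaxCofIso θ}

/-- `mul` is the Higman–Thompson multiplication: `mul φ₁ φ₂` is the (unique) maximal
extension of the composite `u ↦ φ₂ (φ₁ u)`. -/
def IsHTMul (n r : ℕ) (mul : HT n r → HT n r → HT n r) : Prop :=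
  ∀ φ₁ φ₂ : HT n r, HTExtends (mul φ₁ φ₂).val (PFun.comp φ₂.val φ₁.val)

namespace HigmanThompson

/-! ### Words acting on a set `C` with a bijection `Fin n × C ≃ C` -/

section Words

variable {n r : ℕ} {C : Type} (e : Fin n × C ≃ C)

/-- The injection `C → C` attached to a finite word. -/
def wordMap (w : List (Fin n)) (c : C) : C := w.foldr (fun a c => e (a, c)) c

@[simp] theorem wordMap_nil (c : C) : wordMap e [] c = c := rfl

@[simp] theorem wordMap_cons (a : Fin n) (w : List (Fin n)) (c : C) :
    wordMap e (a :: w) c = e (a, wordMap e w c) := rfl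

@[simp] theorem wordMap_append (w w' : List (Fin n)) (c : C) :
    wordMap e (w ++ w') c = wordMap e w (wordMap e w' c) := by
  simp [wordMap, List.foldr_append]

theorem exists_wordMap_eq (K : ℕ) (c : C) :
    ∃ w : List (Fin n), ∃ c', w.length = K ∧ wordMap e w c' = c := by
  induction K generalizing c with
  | zero => exact ⟨[], c, rfl, rfl⟩
  | succ K ih =>
    obtain ⟨w, c', hw, h⟩ := ih (e.symm c).2
    exact ⟨(e.symm c).1 :: w, c', by simp [hw], by simp [h]⟩

theorem wordMap_inj {w w' : List (Fin n)} {c c' : C} (hl : w.length = w'.length)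
    (h : wordMap e w c = wordMap e w' c') : w = w' ∧ c = c' := by
  induction w generalizing w' with
  | nil =>
    obtain rfl : w' = [] := by simpa using hl.symm
    exact ⟨rfl, h⟩
  | cons a w ih =>
    cases w' with
    | nil => simp at hl
    | cons b w' =>
      simp only [wordMap_cons, EmbeddingLike.apply_eq_iff_eq, Prod.mk.injEq] at h
      obtain ⟨h₁, h₂⟩ := ih (by simpa using hl) h.2
      exact ⟨by rw [h.1, h₁], h₂⟩

/-- The injection `C → Fin r × C` attached to an element of `X_r W_n`. -/
def coneMap (u : HTPt n r) (c : C) : Fin r × C := (u.1, wordMap e u.2 c)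

/-- The cone of points of `Fin r × C` lying below an element of `X_r W_n`. -/
def cone (u : HTPt n r) : Set (Fin r × C) := Set.range (coneMap e u)

@[simp] theorem coneMap_HTact (u : HTPt n r) (w : List (Fin n)) (c : C) :
    coneMap e (HTact u w) c = coneMap e u (wordMap e w c) := by
  simp [coneMap, HTact]

@[simp] theorem HTact_nil (u : HTPt n r) : HTact u [] = u := by simp [HTact]

@[simp] theorem HTact_HTact (u : HTPt n r) (w w' : List (Fin n)) :
    HTact (HTact u w) w' = HTact u (w ++ w') := by simp [HTact]

theorem length_HTact (u : HTPt n r) (w : List (Fin n)) :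
    (HTact u w).2.length = u.2.length + w.length := by simp [HTact]

theorem HTact_right_injective (u : HTPt n r) : Function.Injective (HTact u) := by
  intro w w' h
  simpa [HTact] using h

theorem coneMap_mem_cone (u : HTPt n r) (c : C) : coneMap e u c ∈ cone e u := ⟨c, rfl⟩

theorem cone_HTact_subset (u : HTPt n r) (w : List (Fin n)) : cone e (HTact u w) ⊆ cone e u := by
  rintro _ ⟨c, rfl⟩
  exact ⟨_, (coneMap_HTact e u w c).symm⟩

theorem cone_nonempty [Nonempty C] (u : HTPt n r) : (cone e u).Nonempty :=
  Set.range_nonempty _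

theorem exists_coneMap_eq (K : ℕ) (x : Fin r × C) :
    ∃ u : HTPt n r, ∃ c, u.2.length = K ∧ coneMap e u c = x := by
  obtain ⟨w, c, hw, h⟩ := exists_wordMap_eq e K x.2
  exact ⟨(x.1, w), c, hw, by simp [coneMap, h]⟩

theorem coneMap_inj {u v : HTPt n r} {c c' : C} (hl : u.2.length = v.2.length)
    (h : coneMap e u c = coneMap e v c') : u = v ∧ c = c' := by
  simp only [coneMap, Prod.mk.injEq] at h
  obtain ⟨h₁, h₂⟩ := wordMap_inj e hl h.2
  exact ⟨Prod.ext h.1 h₁, h₂⟩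

theorem coneMap_injective (u : HTPt n r) : Function.Injective (coneMap e u) :=
  fun _ _ h => (coneMap_inj e rfl h).2

theorem exists_eq_HTact (u : HTPt n r) {K : ℕ} (h : K ≤ u.2.length) :
    ∃ (u₀ : HTPt n r) (w : List (Fin n)), u = HTact u₀ w ∧ u₀.2.length = K :=
  ⟨(u.1, u.2.take K), u.2.drop K, by simp [HTact], by simpa using h⟩

theorem exists_HTact_of_coneMap_eq {u v : HTPt n r} {c c' : C}
    (hl : u.2.length ≤ v.2.length) (h : coneMap e u c = coneMap e v c') :
    ∃ w, v = HTact u w ∧ c = wordMap e w c' := by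
  obtain ⟨v₀, w, rfl, hv₀⟩ := exists_eq_HTact v hl
  rw [coneMap_HTact] at h
  obtain ⟨rfl, h₂⟩ := coneMap_inj e hv₀.symm h
  exact ⟨w, rfl, h₂⟩

theorem disjoint_cone_of_length_eq {u v : HTPt n r} (hl : u.2.length = v.2.length)
    (h : u ≠ v) : Disjoint (cone e u) (cone e v) := by
  rw [Set.disjoint_left]
  rintro _ ⟨c, rfl⟩ ⟨c', h'⟩
  exact h (coneMap_inj e hl h'.symm).1

theorem disjoint_cone_or (u v : HTPt n r) (hl : u.2.length ≤ v.2.length) :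
    Disjoint (cone e u) (cone e v) ∨ ∃ w, v = HTact u w := by
  by_cases h : Disjoint (cone e u) (cone e v)
  · exact .inl h
  · obtain ⟨_, ⟨c, rfl⟩, ⟨c', h'⟩⟩ := Set.not_disjoint_iff.1 h
    obtain ⟨w, hw, -⟩ := exists_HTact_of_coneMap_eq e hl h'.symm
    exact .inr ⟨w, hw⟩

theorem exists_disjoint_of_HTact (hn : 2 ≤ n) (u : HTPt n r) {w : List (Fin n)} (hw : w ≠ []) :
    ∃ s, Disjoint (cone e (HTact u s)) (cone e (HTact (HTact u w) s)) := by
  obtain ⟨a, w, rfl⟩ := List.exists_cons_of_ne_nil hw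
  have : Nontrivial (Fin n) := Fin.nontrivial_iff_two_le.2 hn
  obtain ⟨b, hb⟩ := exists_ne a
  refine ⟨[b], ?_⟩
  have h := disjoint_cone_of_length_eq e (u := HTact u [b]) (v := HTact u [a])
    (by simp [length_HTact]) (fun h => hb (by simpa using HTact_right_injective u h))
  refine h.mono_right ?_
  have : HTact (HTact u (a :: w)) [b] = HTact (HTact u [a]) (w ++ [b]) := by simp
  rw [this]
  exact cone_HTact_subset e _ _

theorem exists_disjoint_extension (hn : 2 ≤ n) {u v : HTPt n r} (h : u ≠ v) :
    ∃ s, Disjoint (cone e (HTact u s)) (cone e (HTact v s)) := by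
  rcases le_total u.2.length v.2.length with hl | hl
  · rcases disjoint_cone_or e u v hl with hd | ⟨w, rfl⟩
    · exact ⟨[], by simpa using hd⟩
    · exact exists_disjoint_of_HTact e hn u (by rintro rfl; simp at h)
  · rcases disjoint_cone_or e v u hl with hd | ⟨w, rfl⟩
    · exact ⟨[], by simpa using hd.symm⟩
    · obtain ⟨s, hs⟩ := exists_disjoint_of_HTact e hn v (w := w) (by rintro rfl; simp at h)
      exact ⟨s, hs.symm⟩

theorem eq_of_coneMap_eq [Nonempty C] (hn : 2 ≤ n) {u v : HTPt n r}
    (h : ∀ c, coneMap e u c = coneMap e v c) : u = v := by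
  by_contra hne
  obtain ⟨s, hs⟩ := exists_disjoint_extension e hn hne
  obtain ⟨c⟩ := ‹Nonempty C›
  refine Set.disjoint_left.1 hs (coneMap_mem_cone e _ c) ?_
  rw [coneMap_HTact, h, ← coneMap_HTact]
  exact coneMap_mem_cone e _ c

end Words

/-! ### Tame maps and the prefix replacement group -/

section Tame

variable {n r : ℕ} {C : Type} (e : Fin n × C ≃ C)

/-- `f` replaces prefixes of length `K`. -/
def TameAt (K : ℕ) (f : Fin r × C → Fin r × C) : Prop :=
  ∀ u : HTPt n r, u.2.length = K → ∃ v, ∀ c, f (coneMap e u c) = coneMap e v c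

variable {e}

theorem TameAt.of_le {K : ℕ} {f : Fin r × C → Fin r × C} (h : TameAt e K f) {u : HTPt n r}
    (hu : K ≤ u.2.length) : ∃ v, ∀ c, f (coneMap e u c) = coneMap e v c := by
  obtain ⟨u₀, w, rfl, hu₀⟩ := exists_eq_HTact u hu
  obtain ⟨v, hv⟩ := h u₀ hu₀
  exact ⟨HTact v w, fun c => by rw [coneMap_HTact, hv, coneMap_HTact]⟩

theorem TameAt.mono {K L : ℕ} {f : Fin r × C → Fin r × C} (h : TameAt e K f) (hKL : K ≤ L) :
    TameAt e L f := fun _ hu => h.of_le (hu ▸ hKL)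

theorem TameAt.id (K : ℕ) : TameAt e K (id : Fin r × C → Fin r × C) :=
  fun u _ => ⟨u, fun _ => rfl⟩

theorem TameAt.comp {K L : ℕ} {f g : Fin r × C → Fin r × C} (hf : TameAt e K f)
    (hg : TameAt e L g) : TameAt e (K + L) (f ∘ g) := by
  intro u hu
  obtain ⟨u₀, w, rfl, hu₀⟩ := exists_eq_HTact u (K := L) (by omega)
  obtain ⟨v, hv⟩ := hg u₀ hu₀
  rw [length_HTact] at hu
  obtain ⟨v', hv'⟩ := hf.of_le (u := HTact v w) (by rw [length_HTact]; omega)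
  exact ⟨v', fun c => by rw [Function.comp_apply, coneMap_HTact, hv, ← coneMap_HTact, hv']⟩

theorem finite_length_eq (K : ℕ) : {u : HTPt n r | u.2.length = K}.Finite := by
  refine ((Set.finite_univ (α := Fin r)).prod (List.finite_length_eq (Fin n) K)).subset ?_
  intro u hu
  exact ⟨trivial, hu⟩

theorem finite_length_lt (K : ℕ) : {u : HTPt n r | u.2.length < K}.Finite := by
  refine ((Set.finite_univ (α := Fin r)).prod (List.finite_length_lt (Fin n) K)).subset ?_
  intro u hu
  exact ⟨trivial, hu⟩

theorem exists_length_lt {S : Set (HTPt n r)} (hS : S.Finite) : ∃ K, ∀ u ∈ S, u.2.length < K := by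
  obtain ⟨K, hK⟩ := (hS.image fun u => u.2.length).bddAbove
  exact ⟨K + 1, fun u hu => Nat.lt_succ_of_le (hK ⟨u, hu, rfl⟩)⟩

theorem TameAt.symm {K : ℕ} {f : Equiv.Perm (Fin r × C)} (hf : TameAt e K f) :
    ∃ L, TameAt e L f.symm := by
  choose! φ hφ using hf
  obtain ⟨L, hL⟩ := exists_length_lt ((finite_length_eq (n := n) (r := r) K).image φ)
  refine ⟨L, fun v hv => ?_⟩
  by_cases hC : Nonempty C
  · obtain ⟨c⟩ := hC
    obtain ⟨u, c', hu, h⟩ := exists_coneMap_eq e K (f.symm (coneMap e v c))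
    have hfu := hφ u hu c'
    rw [h, Equiv.apply_symm_apply] at hfu
    obtain ⟨w, hw, -⟩ := exists_HTact_of_coneMap_eq e
      ((hL _ ⟨u, hu, rfl⟩).le.trans hv.ge) hfu.symm
    refine ⟨HTact u w, fun c => ?_⟩
    rw [Equiv.symm_apply_eq, hw, coneMap_HTact, coneMap_HTact, hφ u hu]
  · exact ⟨v, fun c => (hC ⟨c⟩).elim⟩

variable (e r) in
/-- The group of prefix replacement permutations of `Fin r × C`. -/
def prefixGroup : Subgroup (Equiv.Perm (Fin r × C)) where
  carrier := {f | ∃ K, TameAt e K f}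
  mul_mem' := by
    rintro f g ⟨K, hf⟩ ⟨L, hg⟩
    exact ⟨K + L, hf.comp hg⟩
  one_mem' := ⟨0, TameAt.id 0⟩
  inv_mem' := by
    rintro f ⟨K, hf⟩
    exact hf.symm

end Tame


/-! ### The Higman–Thompson group as a prefix replacement group -/

section Induces

variable {n r : ℕ} {C : Type} {e : Fin n × C ≃ C}

theorem existsUnique_coneMap_rel {S : HTPt n r → HTPt n r → Prop}
    (hact : ∀ u v, S u v → ∀ w, S (HTact u w) (HTact v w))
    (hfun : ∀ u v v', S u v → S u v' → v = v') (hcof : {u | ∃ v, S u v}ᶜ.Finite)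
    (x : Fin r × C) :
    ∃! y, ∃ u v c, S u v ∧ coneMap e u c = x ∧ coneMap e v c = y := by
  have key : ∀ u v c u' v' c', u.2.length ≤ u'.2.length → S u v → S u' v' →
      coneMap e u c = coneMap e u' c' → coneMap e v c = coneMap e v' c' := by
    intro u v c u' v' c' hl h h' hc
    obtain ⟨w, rfl, rfl⟩ := exists_HTact_of_coneMap_eq e hl hc
    rw [hfun _ _ _ h' (hact _ _ h w), coneMap_HTact]
  obtain ⟨K, hK⟩ := exists_length_lt hcof
  obtain ⟨u, c, hu, rfl⟩ := exists_coneMap_eq e K x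
  have hu' : ∃ v, S u v := by
    by_contra hne
    exact absurd (hK u hne) (by omega)
  obtain ⟨v, hv⟩ := hu'
  refine ⟨coneMap e v c, ⟨u, v, c, hv, rfl, rfl⟩, ?_⟩
  rintro _ ⟨u', v', c', h', hc, rfl⟩
  rcases le_total u.2.length u'.2.length with hl | hl
  · exact (key _ _ _ _ _ _ hl hv h' hc.symm).symm
  · exact key _ _ _ _ _ _ hl h' hv hc

/-- `f` acts on cones in the way prescribed by the partial map `θ`. -/
def Induces (e : Fin n × C ≃ C) (f : Equiv.Perm (Fin r × C)) (θ : HTPt n r →. HTPt n r) : Prop :=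
  ∀ u v, v ∈ θ u → ∀ c, f (coneMap e u c) = coneMap e v c

theorem exists_induces (e : Fin n × C ≃ C) {θ : HTPt n r →. HTPt n r} (hθ : IsCofIso θ) :
    ∃ f ∈ prefixGroup r e, Induces e f θ := by
  obtain ⟨-, hdom, -, hran, hact, hinj⟩ := hθ
  have hdom' : {u | ∃ v, v ∈ θ u}ᶜ.Finite := by
    refine hdom.subset fun u hu hu' => hu ?_
    exact (PFun.mem_dom θ u).1 hu'
  choose f hf hf' using existsUnique_coneMap_rel (e := e) (S := fun u v => v ∈ θ u) hact
    (fun u v v' h h' => Part.mem_unique h h') hdom'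
  choose g hg hg' using existsUnique_coneMap_rel (e := e) (S := fun v u => v ∈ θ u)
    (fun u v h w => hact v u h w) (fun u v v' h h' => hinj _ _ _ h h') hran
  simp only at hf hg hf' hg'
  refine ⟨⟨f, g, fun x => ?_, fun x => ?_⟩, ?_, ?_⟩
  · obtain ⟨u, v, c, h, h₁, h₂⟩ := hf x
    exact (hg' _ _ ⟨v, u, c, h, h₂, h₁⟩).symm
  · obtain ⟨u, v, c, h, h₁, h₂⟩ := hg x
    exact (hf' _ _ ⟨v, u, c, h, h₂, h₁⟩).symm
  · obtain ⟨K, hK⟩ := exists_length_lt hdom'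
    refine ⟨K, fun u hu => ?_⟩
    have hu' : ∃ v, v ∈ θ u := by
      by_contra hne
      exact absurd (hK u hne) (by omega)
    obtain ⟨v, hv⟩ := hu'
    exact ⟨v, fun c => (hf' _ _ ⟨u, v, c, hv, rfl, rfl⟩).symm⟩
  · exact fun u v hv c => (hf' _ _ ⟨u, v, c, hv, rfl, rfl⟩).symm

theorem Induces.unique {θ : HTPt n r →. HTPt n r} (hdom : IsCofinite θ.Dom)
    {f g : Equiv.Perm (Fin r × C)} (hf : Induces e f θ) (hg : Induces e g θ) : f = g := by
  ext1 x
  obtain ⟨K, hK⟩ := exists_length_lt hdom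
  obtain ⟨u, c, hu, rfl⟩ := exists_coneMap_eq e K x
  have hu' : u ∈ θ.Dom := by
    by_contra hne
    exact absurd (hK u hne) (by omega)
  obtain ⟨v, hv⟩ := (PFun.mem_dom θ u).1 hu'
  rw [hf u v hv, hg u v hv]

variable (e) in
/-- The partial map on `X_r W_n` consisting of all prefix replacements performed by `f`. -/
noncomputable def prefixPFun (f : Equiv.Perm (Fin r × C)) : HTPt n r →. HTPt n r :=
  fun u => ⟨∃ v, ∀ c, f (coneMap e u c) = coneMap e v c, fun h => h.choose⟩

theorem mem_prefixPFun [Nonempty C] (hn : 2 ≤ n) {f : Equiv.Perm (Fin r × C)} {u v : HTPt n r} :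
    v ∈ prefixPFun e f u ↔ ∀ c, f (coneMap e u c) = coneMap e v c := by
  constructor
  · rintro ⟨h, rfl⟩
    exact h.choose_spec
  · intro h
    refine ⟨⟨v, h⟩, eq_of_coneMap_eq e hn fun c => ?_⟩
    rw [← h]
    exact ((⟨v, h⟩ : ∃ v, ∀ c, f (coneMap e u c) = coneMap e v c).choose_spec c).symm

theorem isCofinite_prefixPFun_dom {f : Equiv.Perm (Fin r × C)}
    (hf : f ∈ prefixGroup r e) : IsCofinite (prefixPFun e f).Dom := by
  obtain ⟨K, hK⟩ := hf
  refine (finite_length_lt K).subset fun u hu => ?_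
  by_contra hlt
  exact hu (hK.of_le (not_lt.1 hlt))

theorem isSubspace_prefixPFun_dom (hr : 1 ≤ r) {f : Equiv.Perm (Fin r × C)} (hn : 1 ≤ n)
    (hf : f ∈ prefixGroup r e) : IsSubspace (prefixPFun e f).Dom := by
  refine ⟨?_, ?_⟩
  · obtain ⟨K, hK⟩ := hf
    exact ⟨(⟨0, hr⟩, List.replicate K ⟨0, hn⟩), hK.of_le (by simp)⟩
  · rintro u ⟨v, hv⟩ w
    exact ⟨HTact v w, fun c => by rw [coneMap_HTact, hv, coneMap_HTact]⟩

theorem prefixPFun_ran [Nonempty C] (hn : 2 ≤ n) (f : Equiv.Perm (Fin r × C)) :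
    (prefixPFun e f).ran = (prefixPFun e f⁻¹).Dom := by
  ext v
  constructor
  · rintro ⟨u, hu⟩
    rw [mem_prefixPFun hn] at hu
    exact ⟨u, fun c => by rw [← hu]; simp⟩
  · rintro ⟨u, hu⟩
    exact ⟨u, (mem_prefixPFun hn).2 fun c => by rw [← hu]; simp⟩

theorem isCofIso_prefixPFun [Nonempty C] (hn : 2 ≤ n) (hr : 1 ≤ r) {f : Equiv.Perm (Fin r × C)}
    (hf : f ∈ prefixGroup r e) : IsCofIso (prefixPFun e f) := by
  refine ⟨isSubspace_prefixPFun_dom hr (by omega) hf, isCofinite_prefixPFun_dom hf, ?_, ?_, ?_, ?_⟩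
  · rw [prefixPFun_ran hn]
    exact isSubspace_prefixPFun_dom hr (by omega) (inv_mem hf)
  · rw [prefixPFun_ran hn]
    exact isCofinite_prefixPFun_dom (inv_mem hf)
  · intro u v h w
    rw [mem_prefixPFun hn] at h ⊢
    exact fun c => by rw [coneMap_HTact, h, coneMap_HTact]
  · intro u u' v h h'
    rw [mem_prefixPFun hn] at h h'
    exact eq_of_coneMap_eq e hn fun c => f.injective (by rw [h, h'])

theorem induces_prefixPFun [Nonempty C] (hn : 2 ≤ n) (f : Equiv.Perm (Fin r × C)) :
    Induces e f (prefixPFun e f) := fun _ _ h => (mem_prefixPFun hn).1 h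

theorem isMaxCofIso_prefixPFun [Nonempty C] (hn : 2 ≤ n) (hr : 1 ≤ r)
    {f : Equiv.Perm (Fin r × C)} (hf : f ∈ prefixGroup r e) :
    IsMaxCofIso (prefixPFun e f) := by
  refine ⟨isCofIso_prefixPFun hn hr hf, fun θ hθ hext => ?_⟩
  obtain ⟨g, -, hg⟩ := exists_induces e hθ
  obtain rfl : f = g := (induces_prefixPFun hn f).unique (isCofinite_prefixPFun_dom hf)
    fun u v h => hg u v (hext u v h)
  exact PFun.ext fun u v => ⟨fun h => (mem_prefixPFun hn).2 (hg u v h), hext u v⟩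

theorem exists_eq_prefixPFun [Nonempty C] (e : Fin n × C ≃ C) (hn : 2 ≤ n) (hr : 1 ≤ r)
    {θ : HTPt n r →. HTPt n r} (hθ : IsMaxCofIso θ) :
    ∃ f ∈ prefixGroup r e, θ = prefixPFun e f := by
  obtain ⟨f, hf, h⟩ := exists_induces e hθ.1
  exact ⟨f, hf, (hθ.2 _ (isCofIso_prefixPFun hn hr hf)
    fun u v huv => (mem_prefixPFun hn).2 (h u v huv)).symm⟩

theorem eq_mul_of_extends_comp [Nonempty C] (hn : 2 ≤ n) {f g k : Equiv.Perm (Fin r × C)}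
    (hf : f ∈ prefixGroup r e) (hg : g ∈ prefixGroup r e)
    (h : HTExtends (prefixPFun e k) (PFun.comp (prefixPFun e g) (prefixPFun e f))) :
    k = g * f := by
  ext1 x
  obtain ⟨K, hK⟩ := hf
  obtain ⟨L, hL⟩ := hg
  obtain ⟨u, c, hu, rfl⟩ := exists_coneMap_eq e K x
  obtain ⟨w, c, hw, rfl⟩ := exists_wordMap_eq e L c
  obtain ⟨v, hv⟩ := hK u hu
  obtain ⟨v', hv'⟩ := hL.of_le (u := HTact v w) (by rw [length_HTact]; omega)
  have hk : v' ∈ prefixPFun e k (HTact u w) := by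
    refine h _ _ (Part.mem_bind (a := HTact v w) ?_ ?_)
    · exact (mem_prefixPFun hn).2 fun c => by rw [coneMap_HTact, hv, coneMap_HTact]
    · exact (mem_prefixPFun hn).2 hv'
  rw [← coneMap_HTact, (mem_prefixPFun hn).1 hk, Equiv.Perm.mul_apply, coneMap_HTact, hv,
    ← coneMap_HTact, hv']

/-- The Higman–Thompson group `G_{n,r}` is isomorphic to the group of prefix replacement
permutations of `Fin r × C`, for every bijection `Fin n × C ≃ C`. -/
theorem nonempty_prefixGroup_mulEquiv [Nonempty C] (e : Fin n × C ≃ C) (hn : 2 ≤ n) (hr : 1 ≤ r)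
    [Group (HT n r)] (hmul : IsHTMul n r (· * ·)) :
    Nonempty (prefixGroup r e ≃* HT n r) := by
  let F : prefixGroup r e → HT n r :=
    fun f => ⟨prefixPFun e (f : Equiv.Perm (Fin r × C))⁻¹,
      isMaxCofIso_prefixPFun hn hr (inv_mem f.2)⟩
  have hF : ∀ f g, F (f * g) = F f * F g := by
    intro f g
    obtain ⟨k, hk, hk'⟩ := exists_eq_prefixPFun e hn hr (F f * F g).2
    have h := hmul (F f) (F g)
    simp only [hk'] at h
    have := eq_mul_of_extends_comp hn (inv_mem f.2) (inv_mem g.2) h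
    refine Subtype.ext (Eq.trans ?_ hk'.symm)
    simp [F, this]
  refine ⟨MulEquiv.ofBijective (MonoidHom.mk' F hF) ⟨fun f g hfg => ?_, fun θ => ?_⟩⟩
  · have hfg' : prefixPFun e (f : Equiv.Perm (Fin r × C))⁻¹ =
        prefixPFun e (g : Equiv.Perm (Fin r × C))⁻¹ := congrArg Subtype.val hfg
    have h := (induces_prefixPFun hn (f : Equiv.Perm (Fin r × C))⁻¹).unique
      (isCofinite_prefixPFun_dom (inv_mem f.2))
        (hfg'.symm ▸ induces_prefixPFun hn (g : Equiv.Perm (Fin r × C))⁻¹)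
    exact Subtype.ext (inv_injective h)
  · obtain ⟨f, hf, h⟩ := exists_eq_prefixPFun e hn hr θ.2
    exact ⟨⟨f⁻¹, inv_mem hf⟩, Subtype.ext (by simp [F, h])⟩

theorem commutator_mulEquiv {G H : Type*} [Group G] [Group H] (φ : G ≃* H) :
    Nonempty (commutator G ≃* commutator H) := by
  have h : (commutator G).map (φ : G →* H) = commutator H := by
    rw [commutator_def, Subgroup.map_commutator, commutator_def,
      ← MonoidHom.range_eq_map, MonoidHom.range_eq_top.2 φ.surjective]
  exact ⟨(φ.subgroupMap _).trans (MulEquiv.subgroupCongr h)⟩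

end Induces

/-! ### Isomorphisms between prefix replacement groups -/

section PrefixCriterion

variable {n r : ℕ} {C : Type} {e : Fin n × C ≃ C}

theorem mem_iff_forall_wordMap {Z : Type} {A : Set (C → Z)}
    (hA : ∀ φ, φ ∈ A ↔ ∀ i, (fun c => φ (e (i, c))) ∈ A) (K : ℕ) (φ : C → Z) :
    φ ∈ A ↔ ∀ w : List (Fin n), w.length = K → (fun c => φ (wordMap e w c)) ∈ A := by
  induction K generalizing φ with
  | zero =>
    constructor
    · intro h w hw
      obtain rfl := List.length_eq_zero_iff.1 hw
      exact h
    · exact fun h => h [] rfl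
  | succ K ih =>
    rw [hA]
    constructor
    · intro h w hw
      obtain ⟨a, w, rfl⟩ := List.exists_cons_of_length_eq_add_one hw
      exact (ih _).1 (h a) w (by simpa using hw)
    · exact fun h i => (ih _).2 fun w hw => h (i :: w) (by simp [hw])

theorem mem_prefixGroup_iff_forall {f : Equiv.Perm (Fin r × C)} :
    f ∈ prefixGroup r e ↔ ∀ A : Set (C → Fin r × C),
      (∀ φ, φ ∈ A ↔ ∀ i, (fun c => φ (e (i, c))) ∈ A) → (∀ j, (fun c => (j, c)) ∈ A) →
        ∀ i, (fun c => f (i, c)) ∈ A := by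
  constructor
  · rintro ⟨K, hK⟩ A hA hbase i
    rw [mem_iff_forall_wordMap hA K]
    intro w hw
    obtain ⟨v, hv⟩ := hK (i, w) hw
    have : (fun c => f (i, wordMap e w c)) = fun c => coneMap e v c := funext hv
    rw [this]
    exact (mem_iff_forall_wordMap hA _ _).1 (hbase v.1) v.2 rfl
  · intro h
    have key := h {φ | ∃ K, ∀ w : List (Fin n), K ≤ w.length →
      ∃ v, ∀ c, φ (wordMap e w c) = coneMap e v c} ?_ ?_
    · choose K hK using key
      refine ⟨Finset.univ.sup K, fun u hu => hK u.1 u.2 ?_⟩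
      rw [hu]
      exact Finset.le_sup (Finset.mem_univ _)
    · intro φ
      constructor
      · rintro ⟨K, hK⟩ i
        exact ⟨K, fun w hw => hK (i :: w) (by simp; omega)⟩
      · intro h
        choose K hK using h
        refine ⟨Finset.univ.sup K + 1, fun w hw => ?_⟩
        obtain ⟨a, w, rfl⟩ := List.exists_cons_of_length_pos (l := w) (by omega)
        refine hK a w (le_trans (Finset.le_sup (Finset.mem_univ a)) ?_)
        simpa using hw
    · exact fun j => ⟨0, fun w _ => ⟨(j, w), fun c => rfl⟩⟩

end PrefixCriterion

section Splittings

variable {M : ℕ} {Ω Z : Type}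

/-- Membership in `A` is tested on the two halves given by the splitting `σ`. -/
def Splits (σ : Ω ⊕ Ω ≃ Ω) (A B D : Set (Ω → Z)) : Prop :=
  ∀ φ, φ ∈ A ↔ (fun c => φ (σ (.inl c))) ∈ B ∧ (fun c => φ (σ (.inr c))) ∈ D

theorem splits_sumComm_iff {σ : Ω ⊕ Ω ≃ Ω} {A B D : Set (Ω → Z)} :
    Splits ((Equiv.sumComm Ω Ω).trans σ) A B D ↔ Splits σ A D B :=
  forall_congr' fun _ => by simp [and_comm]

/-- Given `B ≅ B₁ ⊕ C`, `A₁ ≅ B₁ ⊕ D` and `A ≅ A₁ ⊕ C`, the resulting splitting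
`A ≅ B ⊕ D`. -/
def reassoc (α β γ : Ω ⊕ Ω ≃ Ω) : Ω ⊕ Ω ≃ Ω :=
  (Equiv.sumCongr α.symm (Equiv.refl Ω)).trans <|
    (((Equiv.sumAssoc Ω Ω Ω).trans
      (Equiv.sumCongr (Equiv.refl Ω) (Equiv.sumComm Ω Ω))).trans
        (Equiv.sumAssoc Ω Ω Ω).symm).trans <|
      (Equiv.sumCongr β (Equiv.refl Ω)).trans γ

theorem splits_reassoc_iff {α β γ : Ω ⊕ Ω ≃ Ω} {A A₁ B B₁ D E : Set (Ω → Z)}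
    (hα : Splits α B B₁ E) (hβ : Splits β A₁ B₁ D) :
    Splits (reassoc α β γ) A B D ↔ Splits γ A A₁ E := by
  refine forall_congr' fun φ => ?_
  rw [hα, hβ]
  simp only [reassoc, Equiv.trans_apply, Equiv.sumCongr_apply, Sum.map_inl, Sum.map_inr,
    Equiv.symm_apply_apply, Equiv.sumAssoc_apply_inl_inl, Equiv.sumAssoc_apply_inl_inr,
    Equiv.sumAssoc_apply_inr, Equiv.sumAssoc_symm_apply_inl, Equiv.sumAssoc_symm_apply_inr_inl,
    Equiv.sumAssoc_symm_apply_inr_inr, Equiv.sumComm_apply, Sum.swap_inl, Sum.swap_inr,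
    Equiv.refl_apply]
  tauto

/-- The family `𝓑` is compatible with the splittings `ρ a` of type `a = (a - d) + d`. -/
def SplitClosed (d : ZMod M) (ρ : ZMod M → (Ω ⊕ Ω ≃ Ω)) (𝓑 : ZMod M → Set (Ω → Z)) : Prop :=
  ∀ a, Splits (ρ a) (𝓑 a) (𝓑 (a - d)) (𝓑 d)

/-- Splittings of type `(d + 1 + j) = (1 + j) + d` made from splittings of type
`a = (a - 1) + 1`. -/
def shiftSplitting (d : ZMod M) (ρ : ZMod M → (Ω ⊕ Ω ≃ Ω)) : ℕ → (Ω ⊕ Ω ≃ Ω)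
  | 0 => (Equiv.sumComm Ω Ω).trans (ρ (d + 1))
  | j + 1 => reassoc (ρ (j + 2)) (shiftSplitting d ρ j) (ρ (d + j + 2))

theorem splits_shiftSplitting_zero {d : ZMod M} {ρ : ZMod M → (Ω ⊕ Ω ≃ Ω)}
    {𝓑 : ZMod M → Set (Ω → Z)} :
    Splits (shiftSplitting d ρ 0) (𝓑 (d + 1)) (𝓑 1) (𝓑 d) ↔
      Splits (ρ (d + 1)) (𝓑 (d + 1)) (𝓑 d) (𝓑 1) :=
  splits_sumComm_iff

theorem splits_shiftSplitting_succ {d : ZMod M} {ρ : ZMod M → (Ω ⊕ Ω ≃ Ω)}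
    {𝓑 : ZMod M → Set (Ω → Z)} {j : ℕ}
    (hρ : Splits (ρ (j + 2)) (𝓑 (j + 2)) (𝓑 (j + 1)) (𝓑 1))
    (hj : Splits (shiftSplitting d ρ j) (𝓑 (d + j + 1)) (𝓑 (j + 1)) (𝓑 d)) :
    Splits (shiftSplitting d ρ (j + 1)) (𝓑 (d + j + 2)) (𝓑 (j + 2)) (𝓑 d) ↔
      Splits (ρ (d + j + 2)) (𝓑 (d + j + 2)) (𝓑 (d + j + 1)) (𝓑 1) :=
  splits_reassoc_iff hρ hj

theorem exists_splitClosed_iff [NeZero M] (ρ : ZMod M → (Ω ⊕ Ω ≃ Ω)) {d : ZMod M}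
    (hd : IsUnit d) :
    ∃ ν : ZMod M → (Ω ⊕ Ω ≃ Ω), ∀ 𝓑 : ZMod M → Set (Ω → Z),
      SplitClosed 1 ρ 𝓑 ↔ SplitClosed d ν 𝓑 := by
  refine ⟨fun a => shiftSplitting d ρ (a - d - 1).val, fun 𝓑 => ⟨fun h => ?_, fun h => ?_⟩⟩
  · have key : ∀ j : ℕ, Splits (shiftSplitting d ρ j) (𝓑 (d + j + 1)) (𝓑 (j + 1)) (𝓑 d) := by
      intro j
      induction j with
      | zero =>
        have := h (d + 1)
        rw [add_sub_cancel_right] at this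
        simpa using splits_shiftSplitting_zero.2 this
      | succ j ih =>
        have h₁ := h (j + 2)
        have h₂ := h (d + j + 2)
        rw [show (j + 2 - 1 : ZMod M) = j + 1 by ring] at h₁
        rw [show (d + j + 2 - 1 : ZMod M) = d + j + 1 by ring] at h₂
        have := (splits_shiftSplitting_succ h₁ ih).2 h₂
        rw [show (d + j + 2 : ZMod M) = d + (j + 1 : ℕ) + 1 by push_cast; ring,
          show (j + 2 : ZMod M) = (j + 1 : ℕ) + 1 by push_cast; ring] at this
        exact this
    intro a
    have := key (a - d - 1).val
    rw [ZMod.natCast_zmod_val] at this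
    convert this using 2 <;> ring
  · have hN : ∀ j : ℕ, j < M →
        Splits (shiftSplitting d ρ j) (𝓑 (d + j + 1)) (𝓑 (j + 1)) (𝓑 d) := by
      intro j hj
      have := h (d + j + 1)
      simp only at this
      rw [show (d + j + 1 - d - 1 : ZMod M) = j by ring, ZMod.val_natCast_of_lt hj,
        show (d + j + 1 - d : ZMod M) = j + 1 by ring] at this
      exact this
    have h₀ : Splits (ρ (d + 1)) (𝓑 (d + 1)) (𝓑 (d + 1 - 1)) (𝓑 1) := by
      have := hN 0 (NeZero.pos M)
      rw [add_sub_cancel_right]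
      exact splits_shiftSplitting_zero.1 (by simpa using this)
    have hstep : ∀ a, Splits (ρ (a - d)) (𝓑 (a - d)) (𝓑 (a - d - 1)) (𝓑 1) →
        Splits (ρ a) (𝓑 a) (𝓑 (a - 1)) (𝓑 1) := by
      intro a ha
      obtain ⟨i, hi⟩ : ∃ i, i = (a - d - 1).val := ⟨_, rfl⟩
      have hiM : i < M := hi ▸ ZMod.val_lt _
      have hia : a = d + i + 1 := by
        rw [hi, ZMod.natCast_zmod_val]
        ring
      clear hi
      subst hia
      cases i with
      | zero => simpa using h₀
      | succ j =>
        have h₁ := hN (j + 1) hiM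
        have h₂ := hN j (by omega)
        push_cast at h₁ ha ⊢
        rw [show (d + (j + 1) + 1 - d : ZMod M) = j + 2 by ring,
          show (j + 2 - 1 : ZMod M) = j + 1 by ring] at ha
        rw [show (d + (j + 1) + 1 : ZMod M) = d + j + 2 by ring,
          show (j + 1 + 1 : ZMod M) = j + 2 by ring] at h₁
        have := (splits_shiftSplitting_succ ha h₂).1 h₁
        rw [show (d + (j + 1) + 1 : ZMod M) = d + j + 2 by ring,
          show (d + j + 2 - 1 : ZMod M) = d + j + 1 by ring]
        exact this
    have hchain : ∀ k : ℕ, Splits (ρ (d + 1 + k * d)) (𝓑 (d + 1 + k * d))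
        (𝓑 (d + 1 + k * d - 1)) (𝓑 1) := by
      intro k
      induction k with
      | zero => simpa using h₀
      | succ k ih =>
        refine hstep _ ?_
        rw [show (d + 1 + ((k + 1 : ℕ) : ZMod M) * d - d) = d + 1 + k * d by push_cast; ring]
        exact ih
    intro a
    obtain ⟨d, rfl⟩ := hd
    have := hchain ((a - d - 1) * (↑d⁻¹ : ZMod M)).val
    rw [ZMod.natCast_zmod_val, Units.inv_mul_cancel_right,
      show (d + 1 + (a - d - 1) : ZMod M) = a by ring] at this
    exact this

/-- The permutations of `Ω` that preserve type `a` as far as the splittings `ρ` can tell. -/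
def SplitPerm (d : ZMod M) (ρ : ZMod M → (Ω ⊕ Ω ≃ Ω)) (a : ZMod M) (f : Equiv.Perm Ω) : Prop :=
  ∀ 𝓑 : ZMod M → Set (Ω → Ω), SplitClosed d ρ 𝓑 → id ∈ 𝓑 a → (f : Ω → Ω) ∈ 𝓑 a

theorem splitPerm_comp_mul_iff (d : (ZMod M)ˣ) (ν : ZMod M → (Ω ⊕ Ω ≃ Ω)) (a : ZMod M)
    (f : Equiv.Perm Ω) :
    SplitPerm 1 (fun b => ν ((d : ZMod M) * b)) a f ↔
      SplitPerm (d : ZMod M) ν ((d : ZMod M) * a) f := by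
  constructor
  · intro h 𝓑 h𝓑
    refine h (fun b => 𝓑 ((d : ZMod M) * b)) fun b => ?_
    have := h𝓑 (d * b)
    simpa [mul_sub] using this
  · intro h 𝓑 h𝓑 hid
    have := h (fun b => 𝓑 ((↑d⁻¹ : ZMod M) * b)) (fun b => ?_) (by simpa using hid)
    · simpa using this
    · have := h𝓑 (↑d⁻¹ * b)
      simpa [mul_sub] using this

theorem exists_splitPerm_iff [NeZero M] (ρ : ZMod M → (Ω ⊕ Ω ≃ Ω)) (d : (ZMod M)ˣ) :
    ∃ ρ' : ZMod M → (Ω ⊕ Ω ≃ Ω), ∀ a f,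
      SplitPerm 1 ρ ((d : ZMod M) * a) f ↔ SplitPerm 1 ρ' a f := by
  obtain ⟨ν, hν⟩ := exists_splitClosed_iff (Z := Ω) ρ d.isUnit
  refine ⟨fun b => ν ((d : ZMod M) * b), fun a f => ?_⟩
  rw [splitPerm_comp_mul_iff]
  exact forall_congr' fun 𝓑 => by rw [hν]

/-- The iterated splitting `Fin (k + 1) × Ω ≃ Ω`. -/
def iterSplitting (ρ : ZMod M → (Ω ⊕ Ω ≃ Ω)) : ∀ k : ℕ, Fin (k + 1) × Ω ≃ Ω
  | 0 => Equiv.uniqueProd Ω (Fin 1)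
  | k + 1 => (((finSumFinEquiv (m := k + 1) (n := 1)).symm.prodCongr (Equiv.refl Ω)).trans
      (Equiv.sumProdDistrib _ _ _)).trans <|
        (Equiv.sumCongr (iterSplitting ρ k) (Equiv.uniqueProd Ω (Fin 1))).trans
          (ρ ((k + 2 : ℕ) : ZMod M))

theorem iterSplitting_zero (ρ : ZMod M → (Ω ⊕ Ω ≃ Ω)) (j : Fin 1) (c : Ω) :
    iterSplitting ρ 0 (j, c) = c := rfl

theorem iterSplitting_castSucc (ρ : ZMod M → (Ω ⊕ Ω ≃ Ω)) (k : ℕ) (j : Fin (k + 1)) (c : Ω) :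
    iterSplitting ρ (k + 1) (j.castSucc, c) =
      ρ ((k + 2 : ℕ) : ZMod M) (.inl (iterSplitting ρ k (j, c))) := by
  have : (finSumFinEquiv (m := k + 1) (n := 1)).symm j.castSucc = .inl j :=
    finSumFinEquiv_symm_apply_castAdd j
  simp [iterSplitting, this]

theorem iterSplitting_last (ρ : ZMod M → (Ω ⊕ Ω ≃ Ω)) (k : ℕ) (c : Ω) :
    iterSplitting ρ (k + 1) (Fin.last (k + 1), c) = ρ ((k + 2 : ℕ) : ZMod M) (.inr c) := by
  have : (finSumFinEquiv (m := k + 1) (n := 1)).symm (Fin.last (k + 1)) = .inr 0 :=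
    finSumFinEquiv_symm_apply_natAdd (0 : Fin 1)
  simp [iterSplitting, this]

theorem forall_iterSplitting_succ (ρ : ZMod M → (Ω ⊕ Ω ≃ Ω)) (k : ℕ) (A : Set (Ω → Z))
    (φ : Ω → Z) :
    (∀ j, (fun c => φ (iterSplitting ρ (k + 1) (j, c))) ∈ A) ↔
      (∀ j, (fun c => φ (ρ ((k + 2 : ℕ) : ZMod M) (.inl (iterSplitting ρ k (j, c))))) ∈ A) ∧
        (fun c => φ (ρ ((k + 2 : ℕ) : ZMod M) (.inr c))) ∈ A := by
  rw [Fin.forall_fin_succ']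
  simp only [iterSplitting_castSucc, iterSplitting_last]

theorem SplitClosed.mem_iff {ρ : ZMod M → (Ω ⊕ Ω ≃ Ω)} {𝓑 : ZMod M → Set (Ω → Z)}
    (h : SplitClosed 1 ρ 𝓑) (k : ℕ) (φ : Ω → Z) :
    φ ∈ 𝓑 ((k + 1 : ℕ) : ZMod M) ↔ ∀ j, (fun c => φ (iterSplitting ρ k (j, c))) ∈ 𝓑 1 := by
  induction k generalizing φ with
  | zero =>
    simp [iterSplitting_zero]
  | succ k ih =>
    rw [forall_iterSplitting_succ, h, ← ih fun c => φ (ρ ((k + 2 : ℕ) : ZMod M) (.inl c)),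
      show (((k + 1 + 1 : ℕ) : ZMod M) - 1) = ((k + 1 : ℕ) : ZMod M) by push_cast; ring]

theorem forall_iterSplitting_add {ρ : ZMod M → (Ω ⊕ Ω ≃ Ω)} {A : Set (Ω → Z)}
    (hA : ∀ φ, φ ∈ A ↔ ∀ i, (fun c => φ (iterSplitting ρ M (i, c))) ∈ A) (k : ℕ) (φ : Ω → Z) :
    (∀ j, (fun c => φ (iterSplitting ρ (k + M) (j, c))) ∈ A) ↔
      ∀ j, (fun c => φ (iterSplitting ρ k (j, c))) ∈ A := by
  induction k generalizing φ with
  | zero =>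
    rw [zero_add, ← hA]
    simp [iterSplitting_zero]
  | succ k ih =>
    have hk : ((k + M + 2 : ℕ) : ZMod M) = ((k + 2 : ℕ) : ZMod M) := by
      push_cast
      rw [ZMod.natCast_self, add_zero]
    rw [forall_iterSplitting_succ, ← ih fun c => φ (ρ ((k + 2 : ℕ) : ZMod M) (.inl c)),
      show k + 1 + M = k + M + 1 by ring, forall_iterSplitting_succ, hk]

theorem exists_splitClosed [NeZero M] {ρ : ZMod M → (Ω ⊕ Ω ≃ Ω)} {A : Set (Ω → Z)}
    (hA : ∀ φ, φ ∈ A ↔ ∀ i, (fun c => φ (iterSplitting ρ M (i, c))) ∈ A) :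
    ∃ 𝓑 : ZMod M → Set (Ω → Z), SplitClosed 1 ρ 𝓑 ∧ 𝓑 1 = A := by
  have hmul : ∀ (k l : ℕ) (φ : Ω → Z),
      (∀ j, (fun c => φ (iterSplitting ρ (k + l * M) (j, c))) ∈ A) ↔
      ∀ j, (fun c => φ (iterSplitting ρ k (j, c))) ∈ A := by
    intro k l φ
    induction l with
    | zero => rw [show k + 0 * M = k by ring]
    | succ l ih => rw [show k + (l + 1) * M = k + l * M + M by ring,
        forall_iterSplitting_add hA, ih]
  have hmod : ∀ (k : ℕ) (φ : Ω → Z), (∀ j, (fun c => φ (iterSplitting ρ (k % M) (j, c))) ∈ A) ↔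
      ∀ j, (fun c => φ (iterSplitting ρ k (j, c))) ∈ A := by
    intro k φ
    conv_rhs => rw [← Nat.mod_add_div' k M]
    rw [hmul]
  have hcongr : ∀ (k l : ℕ) (φ : Ω → Z), k % M = l % M →
      ((∀ j, (fun c => φ (iterSplitting ρ k (j, c))) ∈ A) ↔
        ∀ j, (fun c => φ (iterSplitting ρ l (j, c))) ∈ A) := by
    intro k l φ hkl
    rw [← hmod k, ← hmod l, hkl]
  have hzero : ∀ (k : ℕ) (φ : Ω → Z), k = 0 →
      ((∀ j, (fun c => φ (iterSplitting ρ k (j, c))) ∈ A) ↔ φ ∈ A) := by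
    rintro k φ rfl
    simp [iterSplitting_zero]
  refine ⟨fun a => {φ | ∀ j, (fun c => φ (iterSplitting ρ (a - 1).val (j, c))) ∈ A}, ?_, ?_⟩
  · intro a φ
    have ha : (((a - 1 - 1).val + 2 : ℕ) : ZMod M) = a := by
      push_cast
      rw [ZMod.natCast_zmod_val]
      ring
    have hmod' : (a - 1).val % M = ((a - 1 - 1).val + 1) % M := by
      rw [← ZMod.natCast_eq_natCast_iff']
      push_cast
      rw [ZMod.natCast_zmod_val, ZMod.natCast_zmod_val]
      ring
    refine (hcongr _ _ φ hmod').trans ?_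
    rw [forall_iterSplitting_succ, ha]
    exact and_congr_right fun _ => (hzero _ _ (by simp)).symm
  · ext φ
    exact hzero _ _ (by simp)

theorem mem_prefixGroup_iff_splitPerm [NeZero M] (ρ : ZMod M → (Ω ⊕ Ω ≃ Ω)) (k : ℕ)
    (f : Equiv.Perm (Fin (k + 1) × Ω)) :
    f ∈ prefixGroup (k + 1) (iterSplitting ρ M) ↔
      SplitPerm 1 ρ ((k + 1 : ℕ) : ZMod M) ((iterSplitting ρ k).permCongr f) := by
  rw [mem_prefixGroup_iff_forall]
  constructor
  · intro h 𝓑 h𝓑 hid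
    rw [h𝓑.mem_iff] at hid ⊢
    have := h {φ | (fun c => iterSplitting ρ k (φ c)) ∈ 𝓑 1} ?_ hid
    · simpa [Equiv.permCongr_apply] using this
    · intro φ
      have h₁ := h𝓑.mem_iff M fun c => iterSplitting ρ k (φ c)
      rwa [show ((M + 1 : ℕ) : ZMod M) = 1 by simp] at h₁
  · intro h A hA hbase
    have hA' : ∀ φ : Ω → Ω, φ ∈ {φ : Ω → Ω | (fun c => (iterSplitting ρ k).symm (φ c)) ∈ A} ↔
        ∀ i, (fun c => φ (iterSplitting ρ M (i, c))) ∈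
          {φ : Ω → Ω | (fun c => (iterSplitting ρ k).symm (φ c)) ∈ A} := fun φ => hA _
    obtain ⟨𝓑, h𝓑, h1⟩ := exists_splitClosed hA'
    have := h 𝓑 h𝓑
    rw [h𝓑.mem_iff, h𝓑.mem_iff, h1] at this
    simpa [Equiv.permCongr_apply] using this (by simpa using hbase)

theorem nonempty_prefixGroup_mulEquiv_prefixGroup [NeZero M] {k l : ℕ}
    {ρ ρ' : ZMod M → (Ω ⊕ Ω ≃ Ω)}
    (h : ∀ f, SplitPerm 1 ρ ((k + 1 : ℕ) : ZMod M) f ↔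
      SplitPerm 1 ρ' ((l + 1 : ℕ) : ZMod M) f) :
    Nonempty (prefixGroup (k + 1) (iterSplitting ρ M) ≃*
      prefixGroup (l + 1) (iterSplitting ρ' M)) := by
  let φ : Equiv.Perm (Fin (k + 1) × Ω) ≃* Equiv.Perm (Fin (l + 1) × Ω) :=
    ((iterSplitting ρ k).trans (iterSplitting ρ' l).symm).permCongrHom
  have hφ : ∀ f, (iterSplitting ρ' l).permCongr (φ f) = (iterSplitting ρ k).permCongr f := by
    intro f
    ext x
    simp [φ, Equiv.permCongr_apply, Equiv.permCongrHom]
  have hmap : (prefixGroup (k + 1) (iterSplitting ρ M)).map (φ : _ →* _) =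
      prefixGroup (l + 1) (iterSplitting ρ' M) := by
    ext g
    rw [show (φ : _ →* _) = φ.toMonoidHom from rfl, Subgroup.mem_map_equiv,
      mem_prefixGroup_iff_splitPerm, h, ← hφ, MulEquiv.apply_symm_apply,
      ← mem_prefixGroup_iff_splitPerm]
  exact ⟨(φ.subgroupMap _).trans (MulEquiv.subgroupCongr hmap)⟩

end Splittings

theorem dvd_of_natCast_dvd {M k a : ℕ} (hk : k ∣ M) (h : (k : ZMod M) ∣ (a : ZMod M)) :
    k ∣ a := by
  have h' := map_dvd (ZMod.castHom hk (ZMod k)) h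
  rw [map_natCast, map_natCast, ZMod.natCast_self, zero_dvd_iff] at h'
  exact (ZMod.natCast_eq_zero_iff a k).1 h'

theorem eq_gcd_of_natCast_eq {M k a : ℕ} (hk : k ∣ M) {u : ZMod M} (hu : IsUnit u)
    (h : (a : ZMod M) = u * k) : k = Nat.gcd M a := by
  refine Nat.dvd_antisymm (Nat.dvd_gcd hk (dvd_of_natCast_dvd hk (h ▸ Dvd.intro_left u rfl))) ?_
  refine dvd_of_natCast_dvd (Nat.gcd_dvd_left M a) ?_
  rw [← hu.dvd_mul_left, ← h]
  exact Nat.cast_dvd_cast (Nat.gcd_dvd_right M a)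

theorem exists_unit_mul_natCast_eq {M r s : ℕ} (h : Nat.gcd M r = Nat.gcd M s) :
    ∃ d : (ZMod M)ˣ, (r : ZMod M) = d * s := by
  obtain ⟨k, hk, u, hu, hru⟩ := ZMod.eq_unit_mul_divisor (r : ZMod M)
  obtain ⟨l, hl, v, hv, hsv⟩ := ZMod.eq_unit_mul_divisor (s : ZMod M)
  obtain rfl : k = l := by
    rw [eq_gcd_of_natCast_eq hk hu hru, eq_gcd_of_natCast_eq hl hv hsv, h]
  obtain ⟨u, rfl⟩ := hu
  obtain ⟨v, rfl⟩ := hv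
  exact ⟨u * v⁻¹, by rw [hru, hsv]; simp [mul_assoc]⟩

theorem nonempty_HT_mulEquiv {n r s : ℕ} (hn : 2 ≤ n) (hr : 1 ≤ r) (hs : 1 ≤ s)
    [Group (HT n r)] [Group (HT n s)] (hmulr : IsHTMul n r (· * ·)) (hmuls : IsHTMul n s (· * ·))
    (h : Nat.gcd (n - 1) r = Nat.gcd (n - 1) s) : Nonempty (HT n r ≃* HT n s) := by
  obtain ⟨M, rfl⟩ : ∃ M, n = M + 1 := ⟨n - 1, by omega⟩
  obtain ⟨k, rfl⟩ : ∃ k, r = k + 1 := ⟨r - 1, by omega⟩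
  obtain ⟨l, rfl⟩ : ∃ l, s = l + 1 := ⟨s - 1, by omega⟩
  have : NeZero M := ⟨by omega⟩
  obtain ⟨d, hd⟩ := exists_unit_mul_natCast_eq (M := M) (by simpa using h)
  let ρ : ZMod M → (ℕ ⊕ ℕ ≃ ℕ) := fun _ => Equiv.natSumNatEquivNat
  obtain ⟨ρ', hρ'⟩ := exists_splitPerm_iff ρ d
  obtain ⟨φ⟩ := nonempty_prefixGroup_mulEquiv_prefixGroup (k := k) (l := l) (ρ := ρ) (ρ' := ρ')
    fun f => by rw [hd, hρ']
  obtain ⟨φ₁⟩ := nonempty_prefixGroup_mulEquiv (iterSplitting ρ M) hn hr hmulr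
  obtain ⟨φ₂⟩ := nonempty_prefixGroup_mulEquiv (iterSplitting ρ' M) hn hs hmuls
  exact ⟨(φ₁.symm.trans φ).trans φ₂⟩

/-! ### Reconstruction of the clopen algebra from the group -/

section Moved

variable {X : Type*}

/-- The set of points moved by a permutation. -/
def moved (f : Equiv.Perm X) : Set X := {x | f x ≠ x}

theorem mem_moved {f : Equiv.Perm X} {x : X} : x ∈ moved f ↔ f x ≠ x := Iff.rfl

theorem apply_eq_of_notMem_moved {f : Equiv.Perm X} {x : X} (h : x ∉ moved f) : f x = x :=
  not_not.1 h

@[simp] theorem moved_one : moved (1 : Equiv.Perm X) = ∅ := by ext; simp [moved]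

@[simp] theorem moved_inv (f : Equiv.Perm X) : moved f⁻¹ = moved f := by
  ext x
  rw [mem_moved, mem_moved, not_iff_not, Equiv.Perm.inv_eq_iff_eq, eq_comm]

theorem moved_mul_subset (f g : Equiv.Perm X) : moved (f * g) ⊆ moved f ∪ moved g := by
  intro x hx
  by_contra h
  rw [Set.mem_union, not_or] at h
  refine hx ?_
  rw [Equiv.Perm.mul_apply, apply_eq_of_notMem_moved h.2, apply_eq_of_notMem_moved h.1]

theorem moved_conj (f g : Equiv.Perm X) : moved (g * f * g⁻¹) = g '' moved f := by
  ext x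
  rw [Equiv.image_eq_preimage_symm]
  simp only [mem_moved, Equiv.Perm.mul_apply, Set.mem_preimage]
  rw [not_iff_not, ← Equiv.Perm.eq_inv_iff_eq]
  rfl

theorem moved_pow_subset (f : Equiv.Perm X) (k : ℕ) : moved (f ^ k) ⊆ moved f := by
  intro x hx h
  exact hx (Equiv.Perm.pow_apply_eq_self_of_apply_eq_self h k)

theorem moved_nonempty {f : Equiv.Perm X} (h : f ≠ 1) : (moved f).Nonempty := by
  by_contra hne
  rw [Set.not_nonempty_iff_eq_empty] at hne
  refine h (Equiv.ext fun x => apply_eq_of_notMem_moved ?_)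
  rw [hne]
  simp

theorem commute_of_disjoint_moved {f g : Equiv.Perm X} (h : Disjoint (moved f) (moved g)) :
    Commute f g := by
  refine Equiv.Perm.Disjoint.commute fun x => ?_
  by_contra hx
  rw [not_or] at hx
  exact Set.disjoint_left.1 h hx.1 hx.2

theorem apply_mem_moved {f g : Equiv.Perm X} (h : Commute f g) {x : X} (hx : x ∈ moved f) :
    g x ∈ moved f := by
  intro h'
  refine hx (g.injective ?_)
  rw [← Equiv.Perm.mul_apply, ← h.eq, Equiv.Perm.mul_apply, h']

/-- If `f` displaces a set, it only commutes with the trivial permutation supported there. -/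
theorem eq_one_of_commute_of_disjoint {f h : Equiv.Perm X} {U : Set X} (hU : Disjoint (f '' U) U)
    (hh : moved h ⊆ U) (hc : Commute f h) : h = 1 := by
  by_contra hne
  obtain ⟨x, hx⟩ := moved_nonempty hne
  exact Set.disjoint_left.1 hU ⟨x, hh hx, rfl⟩ (hh (apply_mem_moved hc.symm hx))

end Moved

section AlgDisj

open scoped commutatorElement

variable {G H : Type*} [Group G] [Group H]

theorem commute_map_iff (φ : G ≃* H) {f g : G} : Commute (φ f) (φ g) ↔ Commute f g :=
  ⟨fun h => h.of_map φ.injective, fun h => h.map φ⟩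

/-- A group-theoretic substitute for `f` and `g` having disjoint supports. -/
def AlgDisj (f g : G) : Prop :=
  ∀ h, ¬ Commute f h → ∃ f₁ f₂, Commute f₁ g ∧ Commute f₂ g ∧ ⁅f₁, ⁅f₂, h⁆⁆ ≠ 1 ∧
    Commute ⁅f₁, ⁅f₂, h⁆⁆ g

/-- A group-theoretic substitute for the support of `f` being contained in that of `f'`. -/
def AlgSub (f f' : G) : Prop := ∀ g, AlgDisj f' g → Commute f (g ^ 12)

theorem AlgDisj.map (φ : G ≃* H) {f g : G} (hfg : AlgDisj f g) : AlgDisj (φ f) (φ g) := by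
  intro h hh
  obtain ⟨h, rfl⟩ := φ.surjective h
  rw [commute_map_iff] at hh
  obtain ⟨f₁, f₂, h₁, h₂, h₃, h₄⟩ := hfg h hh
  refine ⟨φ f₁, φ f₂, h₁.map φ, h₂.map φ, ?_, ?_⟩
  · rw [← map_commutatorElement, ← map_commutatorElement]
    rwa [Ne, EmbeddingLike.map_eq_one_iff]
  · rw [← map_commutatorElement, ← map_commutatorElement]
    exact h₄.map φ

theorem algDisj_map_iff (φ : G ≃* H) {f g : G} : AlgDisj (φ f) (φ g) ↔ AlgDisj f g :=
  ⟨fun h => by simpa using h.map φ.symm, fun h => h.map φ⟩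

theorem algSub_map_iff (φ : G ≃* H) {f f' : G} : AlgSub (φ f) (φ f') ↔ AlgSub f f' := by
  unfold AlgSub
  rw [φ.surjective.forall]
  simp only [algDisj_map_iff, ← map_pow, commute_map_iff]

end AlgDisj

/-- A group of permutations that is rich locally with respect to an algebra of sets. -/
structure IsLocallyRich {X : Type} (G : Subgroup (Equiv.Perm X))
    (𝒜 : BooleanSubalgebra (Set X)) : Prop where
  image_mem : ∀ g ∈ G, ∀ A ∈ 𝒜, g '' A ∈ 𝒜
  moved_mem : ∀ g ∈ G, IsOfFinOrder g → moved g ∈ 𝒜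
  exists_moved : ∀ A ∈ 𝒜, ∃ g ∈ G, IsOfFinOrder g ∧ moved g = A
  exists_displaced : ∀ A ∈ 𝒜, ∀ x ∈ A, ∀ L : List (Equiv.Perm X), (∀ g ∈ L, g ∈ G ∧ g x ≠ x) →
    ∃ U ∈ 𝒜, U.Nonempty ∧ U ⊆ A ∧ ∀ g ∈ L, Disjoint (g '' U) U
  exists_not_commute : ∀ U ∈ 𝒜, U.Nonempty → ∃ a ∈ G, ∃ b ∈ G, moved a ⊆ U ∧ moved b ⊆ U ∧
    ¬ Commute a b
  exists_pow_ne_one : ∀ U ∈ 𝒜, U.Nonempty → ∃ a ∈ G, moved a ⊆ U ∧ a ^ 12 ≠ 1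

namespace IsLocallyRich

open scoped commutatorElement

variable {X : Type} {G : Subgroup (Equiv.Perm X)} {𝒜 : BooleanSubalgebra (Set X)}

theorem commutator_commutator_eq {f₁ f₂ h : Equiv.Perm X} {U : Set X}
    (hU : Disjoint (h '' U) U) (h₁ : moved f₁ ⊆ U) (h₂ : moved f₂ ⊆ U) :
    ⁅f₁, ⁅f₂, h⁆⁆ = ⁅f₁, f₂⁆ := by
  have hk : moved (h * f₂⁻¹ * h⁻¹) ⊆ h '' U := by
    rw [moved_conj, moved_inv]
    exact Set.image_mono h₂
  have hc : Commute f₁ (h * f₂⁻¹ * h⁻¹) := commute_of_disjoint_moved (hU.symm.mono h₁ hk)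
  have he : ⁅f₂, h⁆ = f₂ * (h * f₂⁻¹ * h⁻¹) := by rw [commutatorElement_def]; group
  rw [he, commutatorElement_def, commutatorElement_def, mul_inv_rev]
  calc f₁ * (f₂ * (h * f₂⁻¹ * h⁻¹)) * f₁⁻¹ * ((h * f₂⁻¹ * h⁻¹)⁻¹ * f₂⁻¹)
      = f₁ * f₂ * ((h * f₂⁻¹ * h⁻¹) * f₁⁻¹ * (h * f₂⁻¹ * h⁻¹)⁻¹) * f₂⁻¹ := by group
    _ = f₁ * f₂ * f₁⁻¹ * f₂⁻¹ := by
      rw [(hc.inv_left.symm).eq, mul_inv_cancel_right]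

theorem algDisj_of_disjoint (hG : IsLocallyRich G 𝒜) {f g : G}
    (hfg : Disjoint (moved (f : Equiv.Perm X)) (moved (g : Equiv.Perm X))) : AlgDisj f g := by
  intro h hfh
  have hx : ∃ x, x ∈ moved (f : Equiv.Perm X) ∧ x ∈ moved (h : Equiv.Perm X) := by
    by_contra! hne
    refine hfh (Subtype.ext ?_)
    exact (commute_of_disjoint_moved (Set.disjoint_left.2 hne)).eq
  obtain ⟨x, hxf, hxh⟩ := hx
  obtain ⟨U, hU𝒜, hU, -, hd⟩ := hG.exists_displaced ⊤ BooleanSubalgebra.top_mem x trivial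
    [(f : Equiv.Perm X), h] (by simp [hxf.out, hxh.out])
  have hdf : Disjoint ((f : Equiv.Perm X) '' U) U := hd _ (by simp)
  have hdh : Disjoint ((h : Equiv.Perm X) '' U) U := hd _ (by simp)
  have hUg : Disjoint U (moved (g : Equiv.Perm X)) := by
    refine hfg.mono_left fun y hy => mem_moved.2 fun hfy => ?_
    exact Set.disjoint_left.1 hdf ⟨y, hy, hfy⟩ hy
  obtain ⟨a, ha, b, hb, haU, hbU, hab⟩ := hG.exists_not_commute U hU𝒜 hU
  have key : ⁅(⟨a, ha⟩ : G), ⁅(⟨b, hb⟩ : G), h⁆⁆ = ⁅(⟨a, ha⟩ : G), (⟨b, hb⟩ : G)⁆ :=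
    Subtype.ext (commutator_commutator_eq hdh haU hbU)
  have hag : Commute (⟨a, ha⟩ : G) g :=
    Subtype.ext (commute_of_disjoint_moved (hUg.mono_left haU)).eq
  have hbg : Commute (⟨b, hb⟩ : G) g :=
    Subtype.ext (commute_of_disjoint_moved (hUg.mono_left hbU)).eq
  refine ⟨⟨a, ha⟩, ⟨b, hb⟩, hag, hbg, ?_, ?_⟩
  · rw [key, Ne, commutatorElement_eq_one_iff_commute]
    exact fun h => hab (congrArg Subtype.val h.eq)
  · rw [key, commutatorElement_def]
    exact ((hag.mul_left hbg).mul_left hag.inv_left).mul_left hbg.inv_left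

theorem moved_commutator_commutator {f₁ f₂ h : Equiv.Perm X} {U : Set X} (hU : moved h ⊆ U)
    {y : X} (hy : y ∈ moved ⁅f₁, ⁅f₂, h⁆⁆) :
    y ∈ U ∨ f₁⁻¹ y ∈ U ∨ f₂⁻¹ y ∈ U ∨ (f₁ * f₂)⁻¹ y ∈ U := by
  have he : ⁅f₁, ⁅f₂, h⁆⁆ = ((f₁ * f₂) * h * (f₁ * f₂)⁻¹) * (f₁ * h⁻¹ * f₁⁻¹) *
      (h * (f₂ * h⁻¹ * f₂⁻¹)) := by
    simp only [commutatorElement_def]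
    group
  rw [he] at hy
  rcases moved_mul_subset _ _ hy with hy | hy
  · rcases moved_mul_subset _ _ hy with hy | hy
    · rw [moved_conj, Equiv.image_eq_preimage_symm] at hy
      exact .inr (.inr (.inr (hU hy)))
    · rw [moved_conj, moved_inv, Equiv.image_eq_preimage_symm] at hy
      exact .inr (.inl (hU hy))
  · rcases moved_mul_subset _ _ hy with hy | hy
    · exact .inl (hU hy)
    · rw [moved_conj, moved_inv, Equiv.image_eq_preimage_symm] at hy
      exact .inr (.inr (.inl (hU hy)))

theorem pow_apply_ne {g : Equiv.Perm X} {x : X} (h : x ∈ moved (g ^ 12)) {i : ℕ} (hi : i ∣ 12) :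
    (g ^ i) x ≠ x := by
  obtain ⟨k, hk⟩ := hi
  rw [hk, pow_mul] at h
  exact moved_pow_subset _ _ h

theorem disjoint_of_algDisj (hG : IsLocallyRich G 𝒜) {f g : G} (hfg : AlgDisj f g) :
    Disjoint (moved (f : Equiv.Perm X)) (moved ((g : Equiv.Perm X) ^ 12)) := by
  rw [Set.disjoint_left]
  intro x hxf hxg
  obtain ⟨U, hU𝒜, hU, -, hd⟩ := hG.exists_displaced ⊤ BooleanSubalgebra.top_mem x trivial
    [(f : Equiv.Perm X), (g : Equiv.Perm X) ^ 1, (g : Equiv.Perm X) ^ 2, (g : Equiv.Perm X) ^ 3,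
      (g : Equiv.Perm X) ^ 4] (by
      simp only [List.forall_mem_cons, List.not_mem_nil, false_imp_iff, implies_true, and_true]
      exact ⟨⟨f.2, hxf⟩, ⟨pow_mem g.2 _, pow_apply_ne hxg (by decide)⟩,
        ⟨pow_mem g.2 _, pow_apply_ne hxg (by decide)⟩,
        ⟨pow_mem g.2 _, pow_apply_ne hxg (by decide)⟩,
        ⟨pow_mem g.2 _, pow_apply_ne hxg (by decide)⟩⟩)
  simp only [List.forall_mem_cons, List.not_mem_nil, false_imp_iff, implies_true, and_true] at hd
  obtain ⟨hdf, hd1, hd2, hd3, hd4⟩ := hd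
  have hdg : ∀ k, 1 ≤ k → k ≤ 4 → ∀ y ∈ U, ((g : Equiv.Perm X) ^ k) y ∉ U := by
    intro k hk₁ hk₄ y hy hy'
    interval_cases k
    · exact Set.disjoint_left.1 hd1 ⟨y, hy, rfl⟩ hy'
    · exact Set.disjoint_left.1 hd2 ⟨y, hy, rfl⟩ hy'
    · exact Set.disjoint_left.1 hd3 ⟨y, hy, rfl⟩ hy'
    · exact Set.disjoint_left.1 hd4 ⟨y, hy, rfl⟩ hy'
  obtain ⟨h, hh, hhU, h12⟩ := hG.exists_pow_ne_one U hU𝒜 hU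
  have hh1 : h ≠ 1 := by
    rintro rfl
    simp at h12
  obtain ⟨f₁, f₂, hc₁, hc₂, hne, hc⟩ := hfg ⟨h, hh⟩ fun hc =>
    hh1 (eq_one_of_commute_of_disjoint hdf hhU (congrArg Subtype.val hc.eq))
  have hc₁' : Commute (f₁ : Equiv.Perm X) g := congrArg Subtype.val hc₁.eq
  have hc₂' : Commute (f₂ : Equiv.Perm X) g := congrArg Subtype.val hc₂.eq
  have hc' : Commute ⁅(f₁ : Equiv.Perm X), ⁅(f₂ : Equiv.Perm X), h⁆⁆ g := congrArg Subtype.val hc.eq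
  have hne' : ⁅(f₁ : Equiv.Perm X), ⁅(f₂ : Equiv.Perm X), h⁆⁆ ≠ 1 := fun h' =>
    hne (Subtype.ext h')
  obtain ⟨y, hy⟩ := moved_nonempty hne'
  let w : Fin 4 → Equiv.Perm X := ![1, f₁⁻¹, f₂⁻¹, (f₁ * f₂)⁻¹]
  have hw : ∀ j, Commute (w j) g := by
    intro j
    fin_cases j
    · exact Commute.one_left _
    · exact hc₁'.inv_left
    · exact hc₂'.inv_left
    · exact (hc₁'.mul_left hc₂').inv_left
  have hj : ∀ i : Fin 5, ∃ j, w j (((g : Equiv.Perm X) ^ (i : ℕ)) y) ∈ U := by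
    intro i
    rcases moved_commutator_commutator hhU (apply_mem_moved (hc'.pow_right i) hy) with
      h | h | h | h
    · exact ⟨0, h⟩
    · exact ⟨1, h⟩
    · exact ⟨2, h⟩
    · exact ⟨3, h⟩
  choose j hj using hj
  obtain ⟨a, b, hab, hjab⟩ := Fintype.exists_ne_map_eq_of_card_lt j (by simp)
  have key : ∀ a b : Fin 5, a < b → j a ≠ j b := by
    intro a b hab hjab
    refine hdg (b - a) (by omega) (by omega) _ (hj a) ?_
    have h' := hj b
    rw [← hjab] at h'
    rw [← Equiv.Perm.mul_apply, ← ((hw (j a)).pow_right _).eq, Equiv.Perm.mul_apply,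
      ← Equiv.Perm.mul_apply (_ ^ _), ← pow_add, Nat.sub_add_cancel (by omega)]
    exact h'
  rcases lt_or_gt_of_ne hab with h | h
  · exact key a b h hjab
  · exact key b a h hjab.symm

theorem moved_subset_iff (hG : IsLocallyRich G 𝒜) {f f' : G}
    (hf' : moved (f' : Equiv.Perm X) ∈ 𝒜) :
    moved (f : Equiv.Perm X) ⊆ moved (f' : Equiv.Perm X) ↔ AlgSub f f' := by
  constructor
  · intro h g hg
    refine Subtype.ext ?_
    exact (commute_of_disjoint_moved ((hG.disjoint_of_algDisj hg).mono_left h)).eq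
  · intro h x hx
    by_contra hx'
    obtain ⟨U, hU𝒜, hU, hUA, hd⟩ := hG.exists_displaced _ (BooleanSubalgebra.compl_mem hf') x hx'
      [(f : Equiv.Perm X)] (by simp [hx.out])
    obtain ⟨a, ha, haU, h12⟩ := hG.exists_pow_ne_one U hU𝒜 hU
    have hdisj : AlgDisj f' ⟨a, ha⟩ :=
      hG.algDisj_of_disjoint (Set.disjoint_left.2 fun y hy hy' => hUA (haU hy') hy)
    exact h12 (eq_one_of_commute_of_disjoint (hd _ (by simp))
      ((moved_pow_subset a 12).trans haU) (congrArg Subtype.val (h _ hdisj).eq))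

/-- The action of the group on the algebra of sets. -/
def imageSet (hG : IsLocallyRich G 𝒜) (g : G) (A : 𝒜) : 𝒜 :=
  ⟨(g : Equiv.Perm X) '' A, hG.image_mem g g.2 A A.2⟩

theorem exists_orderIso {X' : Type} {G' : Subgroup (Equiv.Perm X')}
    {𝒜' : BooleanSubalgebra (Set X')} (hG : IsLocallyRich G 𝒜) (hG' : IsLocallyRich G' 𝒜')
    (φ : G ≃* G') :
    ∃ Φ : 𝒜 ≃o 𝒜', ∀ g A, Φ (hG.imageSet g A) = hG'.imageSet (φ g) (Φ A) := by
  have fin_coe : ∀ {Y : Type} {H : Subgroup (Equiv.Perm Y)} {g : H},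
      IsOfFinOrder (g : Equiv.Perm Y) ↔ IsOfFinOrder g := by
    intro Y H g
    exact Submonoid.isOfFinOrder_coe
  have hex : ∀ A : 𝒜, ∃ g : G, IsOfFinOrder g ∧ moved (g : Equiv.Perm X) = A := by
    intro A
    obtain ⟨g, hg, hfin, hA⟩ := hG.exists_moved A A.2
    exact ⟨⟨g, hg⟩, fin_coe.1 hfin, hA⟩
  choose f hf hfA using hex
  have hmem : ∀ {g : G}, IsOfFinOrder g → moved (g : Equiv.Perm X) ∈ 𝒜 :=
    fun {g} hg => hG.moved_mem _ g.2 (fin_coe.2 hg)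
  have hmem' : ∀ {g : G'}, IsOfFinOrder g → moved (g : Equiv.Perm X') ∈ 𝒜' :=
    fun {g} hg => hG'.moved_mem _ g.2 (fin_coe.2 hg)
  have hφ : ∀ {g : G}, IsOfFinOrder (φ g) ↔ IsOfFinOrder g :=
    fun {g} => Function.Injective.isOfFinOrder_iff (f := (φ : G →* G')) φ.injective
  have hsub : ∀ {g g' : G}, IsOfFinOrder g' →
      (moved (φ g : Equiv.Perm X') ⊆ moved (φ g' : Equiv.Perm X') ↔
        moved (g : Equiv.Perm X) ⊆ moved (g' : Equiv.Perm X)) := by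
    intro g g' h
    rw [hG.moved_subset_iff (hmem h), hG'.moved_subset_iff (hmem' (hφ.2 h)), algSub_map_iff]
  let F : 𝒜 → 𝒜' := fun A => ⟨moved (φ (f A) : Equiv.Perm X'), hmem' (hφ.2 (hf A))⟩
  have hF : ∀ {g : G} {A : 𝒜}, IsOfFinOrder g → moved (g : Equiv.Perm X) = A →
      (F A : Set X') = moved (φ g : Equiv.Perm X') := by
    intro g A hg hgA
    refine Set.Subset.antisymm ?_ ?_
    · exact (hsub hg).2 (by rw [hfA, hgA])
    · exact (hsub (hf A)).2 (by rw [hfA, hgA])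
  have hle : ∀ A B, F A ≤ F B ↔ A ≤ B := by
    intro A B
    change moved (φ (f A) : Equiv.Perm X') ⊆ moved (φ (f B) : Equiv.Perm X') ↔ _
    rw [hsub (hf B), hfA, hfA]
    rfl
  have hsurj : Function.Surjective F := by
    intro B
    obtain ⟨g, hg, hfin, hB⟩ := hG'.exists_moved B B.2
    have hfin' : IsOfFinOrder (φ.symm ⟨g, hg⟩) := by
      rw [← hφ, MulEquiv.apply_symm_apply]
      exact fin_coe.1 hfin
    refine ⟨⟨_, hmem hfin'⟩, Subtype.ext ?_⟩
    rw [hF hfin' rfl, MulEquiv.apply_symm_apply, hB]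
  refine ⟨RelIso.ofSurjective (OrderEmbedding.ofMapLEIff F hle) hsurj, fun g A => Subtype.ext ?_⟩
  change (F _ : Set X') = (φ g : Equiv.Perm X') '' moved (φ (f A) : Equiv.Perm X')
  have hconj : IsOfFinOrder (g * f A * g⁻¹) := by
    exact MonoidHom.isOfFinOrder (MulAut.conj g : G ≃* G).toMonoidHom (hf A)
  rw [hF (g := g * f A * g⁻¹) hconj]
  · rw [map_mul, map_mul, map_inv, ← moved_conj]
    rfl
  · change moved ((g : Equiv.Perm X) * (f A : Equiv.Perm X) * (g : Equiv.Perm X)⁻¹) = _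
    rw [moved_conj, hfA]
    rfl

end IsLocallyRich

/-! ### The class of a clopen set -/

/-- `cls` is an additive invariant of sets in `𝒜` that classifies orbits of proper nonempty sets. -/
structure IsClassFunction {X : Type} {G : Subgroup (Equiv.Perm X)} {𝒜 : BooleanSubalgebra (Set X)}
    (hG : IsLocallyRich G 𝒜) {M : ℕ} (cls : 𝒜 → ZMod M) : Prop where
  map_sup : ∀ A B, Disjoint A B → cls (A ⊔ B) = cls A + cls B
  map_image : ∀ g A, cls (hG.imageSet g A) = cls A
  exists_image_eq : ∀ A B, A ≠ ⊥ → A ≠ ⊤ → B ≠ ⊥ → B ≠ ⊤ → cls A = cls B →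
    ∃ g, hG.imageSet g A = B
  exists_eq : ∀ U ≠ ⊥, ∀ a, ∃ D ≤ U, D ≠ ⊥ ∧ D ≠ U ∧ cls D = a

namespace IsClassFunction

variable {X X' : Type} {G : Subgroup (Equiv.Perm X)} {G' : Subgroup (Equiv.Perm X')}
  {𝒜 : BooleanSubalgebra (Set X)} {𝒜' : BooleanSubalgebra (Set X')}
  {hG : IsLocallyRich G 𝒜} {hG' : IsLocallyRich G' 𝒜'} {M M' : ℕ}
  {cls : 𝒜 → ZMod M} {cls' : 𝒜' → ZMod M'}

theorem exists_addEquiv (hc : IsClassFunction hG cls) (hc' : IsClassFunction hG' cls')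
    (htop : (⊤ : 𝒜) ≠ ⊥) (φ : G ≃* G') {Φ : 𝒜 ≃o 𝒜'}
    (hΦ : ∀ g A, Φ (hG.imageSet g A) = hG'.imageSet (φ g) (Φ A)) :
    ∃ ψ : ZMod M ≃+ ZMod M', ψ (cls ⊤) = cls' ⊤ := by
  have hbot : ∀ {A : 𝒜}, Φ A ≠ ⊥ ↔ A ≠ ⊥ := fun {A} => by rw [Ne, ← Φ.map_bot, Φ.injective.eq_iff]
  have htop' : ∀ {A : 𝒜}, Φ A ≠ ⊤ ↔ A ≠ ⊤ := fun {A} => by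
    rw [Ne, ← Φ.map_top, Φ.injective.eq_iff]
  have key : ∀ A B : 𝒜, A ≠ ⊥ → A ≠ ⊤ → B ≠ ⊥ → B ≠ ⊤ →
      (cls' (Φ A) = cls' (Φ B) ↔ cls A = cls B) := by
    intro A B hA hA' hB hB'
    constructor
    · intro h
      obtain ⟨g, hg⟩ := hc'.exists_image_eq _ _ (hbot.2 hA) (htop'.2 hA') (hbot.2 hB)
        (htop'.2 hB') h
      have h' : Φ (hG.imageSet (φ.symm g) A) = Φ B := by rw [hΦ, MulEquiv.apply_symm_apply, hg]
      rw [← Φ.injective h', hc.map_image]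
    · intro h
      obtain ⟨g, rfl⟩ := hc.exists_image_eq A B hA hA' hB hB' h
      rw [hΦ, hc'.map_image]
  choose D _ hD₀ hD₁ hD using hc.exists_eq ⊤ htop
  have hψ : ∀ A : 𝒜, A ≠ ⊥ → A ≠ ⊤ → cls' (Φ (D (cls A))) = cls' (Φ A) := fun A hA hA' =>
    (key _ _ (hD₀ _) (hD₁ _) hA hA').2 (hD _)
  have hcompl : ∀ {A : 𝒜}, A ≠ ⊤ → Aᶜ ≠ ⊥ := fun h h' => h (compl_eq_bot.1 h')
  have hcompl' : ∀ {A : 𝒜}, A ≠ ⊥ → Aᶜ ≠ ⊤ := fun h h' => h (compl_eq_top.1 h')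
  have hadd : ∀ a b, cls' (Φ (D (a + b))) = cls' (Φ (D a)) + cls' (Φ (D b)) := by
    intro a b
    obtain ⟨A, hA, hA₀, hA₁, rfl⟩ := hc.exists_eq (D 0) (hD₀ 0) a
    obtain ⟨B, hB, hB₀, hB₁, rfl⟩ := hc.exists_eq (D 0)ᶜ (hcompl (hD₁ 0)) b
    have hdisj : Disjoint A B := (disjoint_compl_right (a := D 0)).mono hA hB
    have hAtop : A ≠ ⊤ := fun h => hD₁ 0 (top_le_iff.1 (h ▸ hA))
    have hBtop : B ≠ ⊤ := fun h => hcompl' (hD₀ 0) (top_le_iff.1 (h ▸ hB))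
    have hAB : A ⊔ B ≠ ⊥ := fun h => hA₀ (sup_eq_bot_iff.1 h).1
    have hAB' : A ⊔ B ≠ ⊤ := by
      intro h
      refine hB₁ (le_antisymm hB ?_)
      have h' : (D 0)ᶜ ⊓ (A ⊔ B) = B := by
        rw [inf_sup_left, (disjoint_compl_left.mono_right hA : Disjoint (D 0)ᶜ A).eq_bot,
          bot_sup_eq, inf_eq_right.2 hB]
      rw [h, inf_top_eq] at h'
      exact h'.le
    rw [← hc.map_sup A B hdisj, hψ _ hAB hAB', hψ _ hA₀ hAtop, hψ _ hB₀ hBtop, Φ.map_sup,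
      hc'.map_sup _ _ (hdisj.map_orderIso Φ)]
  let F : ZMod M →+ ZMod M' := AddMonoidHom.mk' (fun a => cls' (Φ (D a))) hadd
  have hbij : Function.Bijective F := by
    constructor
    · intro a b h
      have h' := (key _ _ (hD₀ a) (hD₁ a) (hD₀ b) (hD₁ b)).1 h
      rwa [hD, hD] at h'
    · intro b
      obtain ⟨B, -, hB₀, hB₁, rfl⟩ := hc'.exists_eq ⊤ (Φ.map_top ▸ hbot.2 htop) b
      obtain ⟨A, rfl⟩ := Φ.surjective B
      exact ⟨cls A, hψ A (hbot.1 hB₀) (htop'.1 hB₁)⟩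
  refine ⟨AddEquiv.ofBijective F hbij, ?_⟩
  have hsplit : (⊤ : 𝒜) = D 0 ⊔ (D 0)ᶜ := sup_compl_eq_top.symm
  change cls' (Φ (D (cls ⊤))) = _
  rw [hsplit, hc.map_sup _ _ disjoint_compl_right, hadd, hψ _ (hD₀ 0) (hD₁ 0),
    hψ _ (hcompl (hD₁ 0)) (hcompl' (hD₀ 0)),
    ← hc'.map_sup _ _ (disjoint_compl_right.map_orderIso Φ), ← Φ.map_sup, sup_compl_eq_top,
    Φ.map_top]

end IsClassFunction

theorem eq_and_gcd_eq_of_addEquiv {M M' r s : ℕ} [NeZero M] [NeZero M'] (ψ : ZMod M ≃+ ZMod M')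
    (h : ψ r = s) : M = M' ∧ Nat.gcd M r = Nat.gcd M' s := by
  have hM : M = M' := by
    have := Nat.card_congr ψ.toEquiv
    simpa using this
  subst hM
  refine ⟨rfl, ?_⟩
  have ho : addOrderOf (r : ZMod M) = addOrderOf (s : ZMod M) := by
    rw [← h]
    exact (addOrderOf_injective ψ.toAddMonoidHom ψ.injective _).symm
  rw [ZMod.addOrderOf_coe r (NeZero.ne M), ZMod.addOrderOf_coe s (NeZero.ne M)] at ho
  rw [← Nat.div_div_self (Nat.gcd_dvd_left M r) (NeZero.ne M), ho,
    Nat.div_div_self (Nat.gcd_dvd_left M s) (NeZero.ne M)]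

/-! ### Clopen sets and their bases -/

section Clopen

variable {n r : ℕ} {C : Type} (e : Fin n × C ≃ C)

/-- `A` is a union of cones of level `K`. -/
def ClopenAt (K : ℕ) (A : Set (Fin r × C)) : Prop :=
  ∀ u : HTPt n r, u.2.length = K → ∀ c c', coneMap e u c ∈ A → coneMap e u c' ∈ A

variable {e}

theorem ClopenAt.of_le {K : ℕ} {A : Set (Fin r × C)} (h : ClopenAt e K A) {u : HTPt n r}
    (hu : K ≤ u.2.length) {c : C} (hc : coneMap e u c ∈ A) (c' : C) : coneMap e u c' ∈ A := by
  obtain ⟨u₀, w, rfl, hu₀⟩ := exists_eq_HTact u hu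
  rw [coneMap_HTact] at hc ⊢
  exact h u₀ hu₀ _ _ hc

theorem ClopenAt.mono {K L : ℕ} {A : Set (Fin r × C)} (h : ClopenAt e K A) (hKL : K ≤ L) :
    ClopenAt e L A := fun _ hu _ c' hc => h.of_le (hu ▸ hKL) hc c'

theorem ClopenAt.compl {K : ℕ} {A : Set (Fin r × C)} (h : ClopenAt e K A) : ClopenAt e K Aᶜ :=
  fun u hu c c' hc hc' => hc (h u hu c' c hc')

theorem ClopenAt.union {K L : ℕ} {A B : Set (Fin r × C)} (hA : ClopenAt e K A)
    (hB : ClopenAt e L B) : ClopenAt e (K + L) (A ∪ B) := fun _ hu _ c' hc =>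
  hc.imp (fun h => hA.of_le (by omega) h c') (fun h => hB.of_le (by omega) h c')

theorem ClopenAt.inter {K L : ℕ} {A B : Set (Fin r × C)} (hA : ClopenAt e K A)
    (hB : ClopenAt e L B) : ClopenAt e (K + L) (A ∩ B) := fun _ hu _ c' hc =>
  hc.imp (fun h => hA.of_le (by omega) h c') (fun h => hB.of_le (by omega) h c')

variable (r e) in
/-- The Boolean algebra of finite unions of cones. -/
def clopenAlgebra : BooleanSubalgebra (Set (Fin r × C)) where
  carrier := {A | ∃ K, ClopenAt e K A}
  supClosed' := fun _ ⟨_, hA⟩ _ ⟨_, hB⟩ => ⟨_, hA.union hB⟩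
  infClosed' := fun _ ⟨_, hA⟩ _ ⟨_, hB⟩ => ⟨_, hA.inter hB⟩
  compl_mem' := fun ⟨_, hA⟩ => ⟨_, hA.compl⟩
  bot_mem' := ⟨0, fun _ _ _ _ h => h⟩

theorem cone_mem_clopenAlgebra (u : HTPt n r) : cone e u ∈ clopenAlgebra r e := by
  refine ⟨u.2.length, fun v hv c c' hc => ?_⟩
  obtain ⟨d, hd⟩ := hc
  obtain ⟨rfl, -⟩ := coneMap_inj e hv.symm hd
  exact coneMap_mem_cone e _ _

theorem exists_cone_subset {A : Set (Fin r × C)} (hA : A ∈ clopenAlgebra r e) {x : Fin r × C}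
    (hx : x ∈ A) : ∃ u c, coneMap e u c = x ∧ cone e u ⊆ A := by
  obtain ⟨K, hK⟩ := hA
  obtain ⟨u, c, hu, rfl⟩ := exists_coneMap_eq e K x
  refine ⟨u, c, rfl, ?_⟩
  rintro _ ⟨c', rfl⟩
  exact hK u hu c c' hx

theorem image_mem_clopenAlgebra {f : Equiv.Perm (Fin r × C)} (hf : f ∈ prefixGroup r e)
    {A : Set (Fin r × C)} (hA : A ∈ clopenAlgebra r e) : f '' A ∈ clopenAlgebra r e := by
  obtain ⟨K, hK⟩ := hA
  obtain ⟨L, hL⟩ := inv_mem hf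
  choose! φ hφ using hL
  obtain ⟨M, hM⟩ : ∃ M, ∀ u : HTPt n r, u.2.length = L → (φ u).2.length ≤ M := by
    obtain ⟨M, hM⟩ := exists_length_lt ((finite_length_eq (n := n) (r := r) L).image φ)
    exact ⟨M, fun u hu => (hM _ ⟨u, hu, rfl⟩).le⟩
  refine ⟨L + K, fun u hu c c' hc => ?_⟩
  obtain ⟨u₀, w, rfl, hu₀⟩ := exists_eq_HTact u (K := L) (by omega)
  rw [length_HTact] at hu
  rw [Equiv.image_eq_preimage_symm] at hc ⊢
  have key : ∀ c, f.symm (coneMap e (HTact u₀ w) c) = coneMap e (HTact (φ u₀) w) c := by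
    intro c
    rw [coneMap_HTact, coneMap_HTact]
    exact hφ u₀ hu₀ _
  rw [Set.mem_preimage, key] at hc ⊢
  exact hK.of_le (by rw [length_HTact]; omega) hc c'

variable (e) in
/-- The map `J × C → Fin r × C` attached to a family of elements of `X_r W_n`. -/
def basisMap {J : Type} (b : J → HTPt n r) (p : J × C) : Fin r × C := coneMap e (b p.1) p.2

variable (e) in
/-- The set `A` is the disjoint union of the cones of the family `b`. -/
structure IsBasis {J : Type} (b : J → HTPt n r) (A : Set (Fin r × C)) : Prop where
  injective : Function.Injective (basisMap e b)
  range_eq : Set.range (basisMap e b) = A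

theorem IsBasis.mem_iff {J : Type} {b : J → HTPt n r} {A : Set (Fin r × C)} (h : IsBasis e b A)
    {x : Fin r × C} : x ∈ A ↔ ∃ j c, coneMap e (b j) c = x := by
  rw [← h.range_eq]
  simp [basisMap]

theorem IsBasis.cone_subset {J : Type} {b : J → HTPt n r} {A : Set (Fin r × C)}
    (h : IsBasis e b A) (j : J) : cone e (b j) ⊆ A := by
  rintro _ ⟨c, rfl⟩
  exact h.mem_iff.2 ⟨j, c, rfl⟩

theorem isBasis_cone (u : HTPt n r) : IsBasis e (fun _ : Fin 1 => u) (cone e u) := by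
  refine ⟨fun p q h => Prod.ext (Subsingleton.elim _ _) (coneMap_injective e u h), ?_⟩
  ext x
  simp [basisMap, cone]

theorem IsBasis.comp_equiv {J J' : Type} {b : J → HTPt n r} {A : Set (Fin r × C)}
    (h : IsBasis e b A) (f : J' ≃ J) : IsBasis e (b ∘ f) A := by
  have : basisMap e (b ∘ f) = basisMap e b ∘ (f.prodCongr (Equiv.refl C)) := rfl
  refine ⟨this ▸ h.injective.comp (Equiv.injective _), ?_⟩
  rw [this, (Equiv.surjective _).range_comp, h.range_eq]

theorem IsBasis.comp_injective {J J' : Type} {b : J → HTPt n r} {A : Set (Fin r × C)}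
    (h : IsBasis e b A) {f : J' → J} (hf : Function.Injective f) :
    IsBasis e (b ∘ f) (⋃ j, cone e (b (f j))) := by
  refine ⟨fun p q hpq => ?_, ?_⟩
  · have := @h.injective (f p.1, p.2) (f q.1, q.2) hpq
    rw [Prod.mk.injEq] at this
    exact Prod.ext (hf this.1) this.2
  · ext x
    simp [basisMap, cone]

theorem IsBasis.sum {J J' : Type} {b : J → HTPt n r} {b' : J' → HTPt n r}
    {A A' : Set (Fin r × C)} (h : IsBasis e b A) (h' : IsBasis e b' A') (hd : Disjoint A A') :
    IsBasis e (Sum.elim b b') (A ∪ A') := by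
  constructor
  · rintro ⟨j | j, c⟩ ⟨k | k, d⟩ hp
    · simpa using @h.injective (j, c) (k, d) hp
    · exact (Set.disjoint_left.1 hd (h.mem_iff.2 ⟨j, c, rfl⟩)
        (h'.mem_iff.2 ⟨k, d, hp.symm⟩)).elim
    · exact (Set.disjoint_left.1 hd (h.mem_iff.2 ⟨k, d, rfl⟩)
        (h'.mem_iff.2 ⟨j, c, hp⟩)).elim
    · simpa using @h'.injective (j, c) (k, d) hp
  · ext x
    rw [Set.mem_union, h.mem_iff, h'.mem_iff]
    simp [basisMap]

theorem IsBasis.image {J : Type} {b b' : J → HTPt n r} {A : Set (Fin r × C)} (h : IsBasis e b A)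
    (f : Equiv.Perm (Fin r × C)) (hf : ∀ j c, f (coneMap e (b j) c) = coneMap e (b' j) c) :
    IsBasis e b' (f '' A) := by
  have : basisMap e b' = f ∘ basisMap e b := funext fun p => (hf p.1 p.2).symm
  exact ⟨this ▸ f.injective.comp h.injective, by rw [this, Set.range_comp, h.range_eq]⟩

theorem IsBasis.eq_of_HTact_eq [Nonempty C] {J : Type} {b : J → HTPt n r} {A : Set (Fin r × C)}
    (h : IsBasis e b A) {j k : J} {w w' : List (Fin n)} (hw : HTact (b j) w = HTact (b k) w') :
    j = k ∧ w = w' := by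
  obtain ⟨c⟩ := ‹Nonempty C›
  have : basisMap e b (j, wordMap e w c) = basisMap e b (k, wordMap e w' c) := by
    rw [basisMap, basisMap, ← coneMap_HTact, hw, coneMap_HTact]
  obtain rfl : j = k := congrArg Prod.fst (h.injective this)
  exact ⟨rfl, HTact_right_injective _ hw⟩

theorem exists_length_le {J : Type} [Finite J] (b : J → HTPt n r) :
    ∃ K, ∀ j, (b j).2.length ≤ K := by
  obtain ⟨K, hK⟩ := exists_length_lt (Set.finite_range b)
  exact ⟨K, fun j => (hK _ ⟨j, rfl⟩).le⟩

/-- The words of level `K` whose cones lie in `A`. -/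
abbrev LevelWords (e : Fin n × C ≃ C) (K : ℕ) (A : Set (Fin r × C)) : Type :=
  {u : HTPt n r // u.2.length = K ∧ cone e u ⊆ A}

instance (K : ℕ) (A : Set (Fin r × C)) : Finite (LevelWords e K A) :=
  (Set.Finite.subset (finite_length_eq K) fun _ h => h.1 :
    {u : HTPt n r | u.2.length = K ∧ cone e u ⊆ A}.Finite)

theorem ClopenAt.isBasis {K : ℕ} {A : Set (Fin r × C)} (h : ClopenAt e K A) :
    IsBasis e (Subtype.val : LevelWords e K A → HTPt n r) A := by
  constructor
  · rintro ⟨u, c⟩ ⟨v, d⟩ huv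
    obtain ⟨h₁, h₂⟩ := coneMap_inj e (u.2.1.trans v.2.1.symm) huv
    exact Prod.ext (Subtype.ext h₁) h₂
  · ext x
    constructor
    · rintro ⟨⟨u, c⟩, rfl⟩
      exact u.2.2 (coneMap_mem_cone e _ _)
    · intro hx
      obtain ⟨u, c, hu, rfl⟩ := exists_coneMap_eq e K x
      refine ⟨(⟨u, hu, ?_⟩, c), rfl⟩
      rintro _ ⟨c', rfl⟩
      exact h u hu c c' hx

theorem IsBasis.mem_clopenAlgebra {J : Type} [Finite J] {b : J → HTPt n r} {A : Set (Fin r × C)}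
    (h : IsBasis e b A) : A ∈ clopenAlgebra r e := by
  obtain ⟨K, hK⟩ := exists_length_le b
  refine ⟨K, fun u hu c c' hc => ?_⟩
  obtain ⟨j, d, hd⟩ := h.mem_iff.1 hc
  obtain ⟨w, rfl, -⟩ := exists_HTact_of_coneMap_eq e (by rw [hu]; exact hK j) hd
  exact h.cone_subset j (cone_HTact_subset e _ _ (coneMap_mem_cone e _ _))

/-! ### Permutations of the cones of a basis -/

/-- The permutations of the cones of a basis, acting as prefix replacements. -/
noncomputable def IsBasis.permHom {J : Type} {b : J → HTPt n r} {A : Set (Fin r × C)}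
    (h : IsBasis e b A) : Equiv.Perm J →* Equiv.Perm (Fin r × C) :=
  (Equiv.Perm.viaEmbeddingHom ⟨basisMap e b, h.injective⟩).comp
    { toFun := fun σ => σ.prodCongr (Equiv.refl C)
      map_one' := rfl
      map_mul' := fun _ _ => rfl }

section Perm

variable {J : Type} {b : J → HTPt n r} {A : Set (Fin r × C)} (h : IsBasis e b A)

theorem IsBasis.permHom_coneMap (σ : Equiv.Perm J) (j : J) (c : C) :
    h.permHom σ (coneMap e (b j) c) = coneMap e (b (σ j)) c :=
  Equiv.Perm.viaEmbedding_apply (σ.prodCongr (Equiv.refl C)) ⟨basisMap e b, h.injective⟩ (j, c)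

theorem IsBasis.permHom_of_notMem (σ : Equiv.Perm J) {x : Fin r × C} (hx : x ∉ A) :
    h.permHom σ x = x :=
  Equiv.Perm.viaEmbedding_apply_of_notMem (σ.prodCongr (Equiv.refl C))
    ⟨basisMap e b, h.injective⟩ x (by rw [← h.range_eq] at hx; exact hx)

theorem IsBasis.permHom_mem [Finite J] (σ : Equiv.Perm J) : h.permHom σ ∈ prefixGroup r e := by
  obtain ⟨K, hK⟩ := exists_length_le b
  refine ⟨K, fun u hu => ?_⟩
  by_cases hA : ∃ c, coneMap e u c ∈ A
  · obtain ⟨c, hc⟩ := hA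
    obtain ⟨j, d, hd⟩ := h.mem_iff.1 hc
    obtain ⟨w, rfl, -⟩ := exists_HTact_of_coneMap_eq e (by rw [hu]; exact hK j) hd
    exact ⟨HTact (b (σ j)) w, fun c => by rw [coneMap_HTact, h.permHom_coneMap, coneMap_HTact]⟩
  · exact ⟨u, fun c => h.permHom_of_notMem σ fun hc => hA ⟨c, hc⟩⟩

theorem IsBasis.moved_permHom (σ : Equiv.Perm J) :
    moved (h.permHom σ) = ⋃ j ∈ moved σ, cone e (b j) := by
  ext x
  by_cases hx : x ∈ A
  · obtain ⟨j, c, rfl⟩ := h.mem_iff.1 hx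
    rw [mem_moved, h.permHom_coneMap, Set.mem_iUnion₂]
    constructor
    · intro hne
      exact ⟨j, fun hj => hne (by rw [hj]), coneMap_mem_cone e _ _⟩
    · rintro ⟨k, hk, d, hd⟩ heq
      have h₁ := @h.injective (k, d) (j, c) hd
      have h₂ := @h.injective (σ j, c) (j, c) heq
      rw [Prod.mk.injEq] at h₁ h₂
      exact hk (by rw [h₁.1, h₂.1])
  · rw [mem_moved, h.permHom_of_notMem σ hx]
    simp only [ne_eq, not_true_eq_false, Set.mem_iUnion, exists_prop, false_iff, not_exists,
      not_and]
    exact fun j _ hj => hx (h.cone_subset j hj)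

theorem IsBasis.moved_permHom_subset (σ : Equiv.Perm J) : moved (h.permHom σ) ⊆ A := by
  rw [h.moved_permHom]
  exact Set.iUnion₂_subset fun j _ => h.cone_subset j

theorem IsBasis.permHom_injective [Nonempty C] : Function.Injective h.permHom := by
  intro σ τ hστ
  obtain ⟨c⟩ := ‹Nonempty C›
  ext j
  have := h.permHom_coneMap σ j c
  rw [hστ, h.permHom_coneMap] at this
  exact (congrArg Prod.fst (@h.injective (τ j, c) (σ j, c) this)).symm

open scoped commutatorElement in
theorem IsBasis.permHom_commutator_mem [Finite J] (σ τ : Equiv.Perm J) :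
    h.permHom ⁅σ, τ⁆ ∈ ⁅prefixGroup r e, prefixGroup r e⁆ := by
  rw [map_commutatorElement]
  exact Subgroup.commutator_mem_commutator (h.permHom_mem σ) (h.permHom_mem τ)

end Perm

/-- Two bases of the whole space with the same indices are matched by a prefix replacement. -/
theorem exists_mem_prefixGroup_of_isBasis {J : Type} [Finite J] {b b' : J → HTPt n r}
    (h : IsBasis e b Set.univ) (h' : IsBasis e b' Set.univ) :
    ∃ g ∈ prefixGroup r e, ∀ j c, g (coneMap e (b j) c) = coneMap e (b' j) c := by
  let f := Equiv.ofBijective _ ⟨h.injective, Set.range_eq_univ.1 h.range_eq⟩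
  let f' := Equiv.ofBijective _ ⟨h'.injective, Set.range_eq_univ.1 h'.range_eq⟩
  have key : ∀ j c, (f.symm.trans f') (coneMap e (b j) c) = coneMap e (b' j) c := by
    intro j c
    have : f.symm (coneMap e (b j) c) = (j, c) := f.symm_apply_eq.2 rfl
    rw [Equiv.trans_apply, this]
    rfl
  obtain ⟨K, hK⟩ := exists_length_le b
  refine ⟨f.symm.trans f', ⟨K, fun u hu => ?_⟩, key⟩
  by_cases hC : Nonempty C
  · obtain ⟨c⟩ := hC
    obtain ⟨j, d, hd⟩ := h.mem_iff.1 (Set.mem_univ (coneMap e u c))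
    obtain ⟨w, rfl, -⟩ := exists_HTact_of_coneMap_eq e (by rw [hu]; exact hK j) hd
    exact ⟨HTact (b' j) w, fun c => by rw [coneMap_HTact, key, coneMap_HTact]⟩
  · exact ⟨u, fun c => (hC ⟨c⟩).elim⟩

end Clopen

/-! ### The size of a basis modulo `n - 1` -/

section Size

variable {n r : ℕ} {C : Type} {e : Fin n × C ≃ C}

/-- The words of level `K` below the elements of a basis. -/
noncomputable def IsBasis.levelWordsEquiv [Nonempty C] {J : Type} {b : J → HTPt n r}
    {A : Set (Fin r × C)} (h : IsBasis e b A) {K : ℕ} (hK : ∀ j, (b j).2.length ≤ K) :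
    (Σ j, List.Vector (Fin n) (K - (b j).2.length)) ≃ LevelWords e K A :=
  Equiv.ofBijective
    (fun p => ⟨HTact (b p.1) p.2.1, by
      rw [length_HTact, p.2.2]
      exact Nat.add_sub_cancel' (hK p.1),
      (cone_HTact_subset e _ _).trans (h.cone_subset p.1)⟩) <| by
    constructor
    · rintro ⟨j, w, hw⟩ ⟨k, w', hw'⟩ heq
      obtain ⟨rfl, rfl⟩ := h.eq_of_HTact_eq (congrArg Subtype.val heq)
      rfl
    · rintro ⟨u, hu, huA⟩
      obtain ⟨c⟩ := ‹Nonempty C›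
      obtain ⟨j, d, hd⟩ := h.mem_iff.1 (huA (coneMap_mem_cone e u c))
      obtain ⟨w, rfl, -⟩ := exists_HTact_of_coneMap_eq e (by rw [hu]; exact hK j) hd
      refine ⟨⟨j, w, ?_⟩, rfl⟩
      rw [length_HTact] at hu
      omega

theorem cast_self_of_pos (hn : 1 ≤ n) : (n : ZMod (n - 1)) = 1 := by
  obtain ⟨m, rfl⟩ := Nat.exists_eq_add_of_le' hn
  simp

theorem IsBasis.card_levelWords [Nonempty C] (hn : 1 ≤ n) {J : Type} [Finite J]
    {b : J → HTPt n r} {A : Set (Fin r × C)} (h : IsBasis e b A) {K : ℕ}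
    (hK : ∀ j, (b j).2.length ≤ K) :
    (Nat.card (LevelWords e K A) : ZMod (n - 1)) = Nat.card J := by
  have := Fintype.ofFinite J
  rw [← Nat.card_congr (h.levelWordsEquiv hK), Nat.card_eq_fintype_card, Fintype.card_sigma,
    Nat.card_eq_fintype_card]
  simp [card_vector, cast_self_of_pos hn]

theorem IsBasis.card_eq_card [Nonempty C] (hn : 1 ≤ n) {J J' : Type} [Finite J] [Finite J']
    {b : J → HTPt n r} {b' : J' → HTPt n r} {A : Set (Fin r × C)} (h : IsBasis e b A)
    (h' : IsBasis e b' A) : (Nat.card J : ZMod (n - 1)) = Nat.card J' := by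
  obtain ⟨K, hK⟩ := exists_length_le b
  obtain ⟨K', hK'⟩ := exists_length_le b'
  rw [← h.card_levelWords hn (K := max K K') fun j => (hK j).trans (le_max_left _ _),
    ← h'.card_levelWords hn (K := max K K') fun j => (hK' j).trans (le_max_right _ _)]

/-- A level at which a clopen set is a union of cones. -/
noncomputable def clopenLevel (A : clopenAlgebra r e) : ℕ := A.2.choose

theorem isBasis_clopenLevel (A : clopenAlgebra r e) :
    IsBasis e (Subtype.val : LevelWords e (clopenLevel A) A.1 → HTPt n r) A.1 :=
  A.2.choose_spec.isBasis

/-- The number of cones, modulo `n - 1`, in any partition of a clopen set into cones. -/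
noncomputable def clopenSize (A : clopenAlgebra r e) : ZMod (n - 1) :=
  Nat.card (LevelWords e (clopenLevel A) A.1)

theorem IsBasis.clopenSize_eq [Nonempty C] (hn : 1 ≤ n) {J : Type} [Finite J] {b : J → HTPt n r}
    {A : clopenAlgebra r e} (h : IsBasis e b A.1) : clopenSize A = Nat.card J :=
  (isBasis_clopenLevel A).card_eq_card hn h

theorem clopenSize_sup [Nonempty C] (hn : 1 ≤ n) {A B : clopenAlgebra r e} (h : Disjoint A B) :
    clopenSize (A ⊔ B) = clopenSize A + clopenSize B := by
  have hd : Disjoint A.1 B.1 := by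
    rw [disjoint_iff] at h ⊢
    exact congrArg Subtype.val h
  have := ((isBasis_clopenLevel A).sum (isBasis_clopenLevel B) hd).clopenSize_eq hn (A := A ⊔ B)
  rw [this, Nat.card_sum, Nat.cast_add]
  rfl

theorem clopenSize_eq_of_image [Nonempty C] (hn : 1 ≤ n) {A B : clopenAlgebra r e}
    {f : Equiv.Perm (Fin r × C)} (hf : f ∈ prefixGroup r e) (h : f '' A.1 = B.1) :
    clopenSize B = clopenSize A := by
  obtain ⟨K, hK⟩ := hf
  obtain ⟨L, hL⟩ := A.2
  have hb := (hL.mono (Nat.le_add_left L K)).isBasis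
  choose φ hφ using fun j : LevelWords e (K + L) A.1 => hK.of_le (u := j.1)
    (by rw [j.2.1]; exact Nat.le_add_right K L)
  have hb' := hb.image f (b' := φ) hφ
  rw [h] at hb'
  rw [hb.clopenSize_eq hn, hb'.clopenSize_eq hn]

theorem isBasis_univ : IsBasis e (fun i : Fin r => ((i, []) : HTPt n r)) Set.univ := by
  constructor
  · rintro ⟨i, c⟩ ⟨j, d⟩ h
    exact h
  · ext ⟨i, c⟩
    exact ⟨fun _ => trivial, fun _ => ⟨(i, c), rfl⟩⟩

theorem clopenSize_top [Nonempty C] (hn : 1 ≤ n) :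
    clopenSize (⊤ : clopenAlgebra r e) = (r : ZMod (n - 1)) := by
  have : IsBasis e (fun i : Fin r => ((i, []) : HTPt n r)) (⊤ : clopenAlgebra r e).1 := isBasis_univ
  rw [this.clopenSize_eq hn, Nat.card_fin]

theorem isBasis_split (u : HTPt n r) : IsBasis e (fun a : Fin n => HTact u [a]) (cone e u) := by
  constructor
  · rintro ⟨a, c⟩ ⟨b, d⟩ h
    rw [basisMap, basisMap, coneMap_HTact, coneMap_HTact] at h
    exact e.injective (coneMap_injective e u h)
  · ext x
    constructor
    · rintro ⟨⟨a, c⟩, rfl⟩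
      exact cone_HTact_subset e _ _ (coneMap_mem_cone e _ _)
    · rintro ⟨c, rfl⟩
      exact ⟨e.symm c, by simp [basisMap]⟩

variable (e) in
/-- `A` is a disjoint union of `N` cones. -/
def HasBasis (A : Set (Fin r × C)) (N : ℕ) : Prop := ∃ b : Fin N → HTPt n r, IsBasis e b A

theorem IsBasis.hasBasis {J : Type} [Finite J] {b : J → HTPt n r} {A : Set (Fin r × C)}
    (h : IsBasis e b A) : HasBasis e A (Nat.card J) :=
  ⟨_, h.comp_equiv (Finite.equivFin J).symm⟩

theorem HasBasis.clopenSize_eq [Nonempty C] (hn : 1 ≤ n) {A : clopenAlgebra r e} {N : ℕ}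
    (h : HasBasis e A.1 N) : clopenSize A = N := by
  obtain ⟨b, hb⟩ := h
  rw [hb.clopenSize_eq hn, Nat.card_fin]

theorem exists_hasBasis (A : clopenAlgebra r e) : ∃ N, HasBasis e A.1 N :=
  ⟨_, (isBasis_clopenLevel A).hasBasis⟩

/-- Splitting one cone of a basis produces a basis with `n - 1` more cones. -/
theorem HasBasis.split {A : Set (Fin r × C)} {N : ℕ} (h : HasBasis e A N) (hA : A.Nonempty)
    (hn : 1 ≤ n) : HasBasis e A (N + (n - 1)) := by
  obtain ⟨b, hb⟩ := h
  cases N with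
  | zero =>
    obtain ⟨x, hx⟩ := hA
    obtain ⟨j, -⟩ := hb.mem_iff.1 hx
    exact j.elim0
  | succ N =>
    have h₁ := hb.comp_injective (Fin.succ_injective N)
    have hd : Disjoint (⋃ j : Fin N, cone e (b j.succ)) (cone e (b 0)) := by
      rw [Set.disjoint_iUnion_left]
      intro j
      rw [Set.disjoint_left]
      rintro _ ⟨c, rfl⟩ ⟨d, hd⟩
      have := congrArg Prod.fst (@hb.injective (0, d) (j.succ, c) hd)
      exact (Fin.succ_ne_zero j).symm this
    have h₂ := (h₁.sum (isBasis_split (b 0)) hd).hasBasis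
    have hU : (⋃ j : Fin N, cone e (b j.succ)) ∪ cone e (b 0) = A := by
      ext x
      rw [hb.mem_iff]
      simp [Fin.exists_fin_succ, cone, or_comm]
    rw [hU] at h₂
    convert h₂ using 1
    simp only [Nat.card_sum, Nat.card_fin]
    omega

theorem HasBasis.add_mul {A : Set (Fin r × C)} {N : ℕ} (h : HasBasis e A N) (hA : A.Nonempty)
    (hn : 1 ≤ n) (k : ℕ) : HasBasis e A (N + k * (n - 1)) := by
  induction k with
  | zero => simpa using h
  | succ k ih =>
    rw [Nat.succ_mul, ← Nat.add_assoc]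
    exact ih.split hA hn

theorem exists_hasBasis_ge (hn : 2 ≤ n) {A : Set (Fin r × C)} (hA : A ∈ clopenAlgebra r e)
    (hne : A.Nonempty) (M : ℕ) : ∃ N ≥ M, HasBasis e A N := by
  obtain ⟨N, hN⟩ := exists_hasBasis ⟨A, hA⟩
  refine ⟨_, ?_, hN.add_mul hne (by omega) M⟩
  have : M * 1 ≤ M * (n - 1) := Nat.mul_le_mul_left M (by omega)
  omega

/-- Nonempty clopen sets of equal size admit bases with equal numbers of cones. -/
theorem exists_common_hasBasis [Nonempty C] (hn : 1 ≤ n) {A B : clopenAlgebra r e}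
    (hA : A.1.Nonempty) (hB : B.1.Nonempty) (h : clopenSize A = clopenSize B) :
    ∃ N, HasBasis e A.1 N ∧ HasBasis e B.1 N := by
  obtain ⟨N, hN⟩ := exists_hasBasis A
  obtain ⟨M, hM⟩ := exists_hasBasis B
  rw [hN.clopenSize_eq hn, hM.clopenSize_eq hn, ZMod.natCast_eq_natCast_iff] at h
  rcases le_total N M with hle | hle
  · obtain ⟨k, hk⟩ := (Nat.modEq_iff_dvd' hle).1 h
    refine ⟨M, ?_, hM⟩
    have := hN.add_mul hA hn k
    rwa [Nat.mul_comm, ← hk, Nat.add_sub_cancel' hle] at this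
  · obtain ⟨k, hk⟩ := (Nat.modEq_iff_dvd' hle).1 h.symm
    refine ⟨N, hN, ?_⟩
    have := hM.add_mul hB hn k
    rwa [Nat.mul_comm, ← hk, Nat.add_sub_cancel' hle] at this

/-- Sets admitting bases of equal sizes, and whose complements do, are matched by a prefix
replacement. -/
theorem exists_image_eq_of_hasBasis {A B : Set (Fin r × C)} {N M : ℕ} (hA : HasBasis e A N)
    (hB : HasBasis e B N) (hA' : HasBasis e Aᶜ M) (hB' : HasBasis e Bᶜ M) :
    ∃ g ∈ prefixGroup r e, g '' A = B := by
  obtain ⟨a, ha⟩ := hA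
  obtain ⟨b, hb⟩ := hB
  obtain ⟨a', ha'⟩ := hA'
  obtain ⟨b', hb'⟩ := hB'
  have h₁ := ha.sum ha' disjoint_compl_right
  have h₂ := hb.sum hb' disjoint_compl_right
  rw [Set.union_compl_self] at h₁ h₂
  obtain ⟨g, hg, hgj⟩ := exists_mem_prefixGroup_of_isBasis h₁ h₂
  refine ⟨g, hg, ?_⟩
  have := ha.image g (b' := b) fun j c => hgj (.inl j) c
  rw [← this.range_eq, hb.range_eq]

theorem clopenSize_compl [Nonempty C] (hn : 1 ≤ n) (A : clopenAlgebra r e) :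
    clopenSize A + clopenSize Aᶜ = r := by
  rw [← clopenSize_sup hn disjoint_compl_right, sup_compl_eq_top, clopenSize_top hn]

theorem exists_image_eq_of_clopenSize_eq [Nonempty C] (hn : 1 ≤ n) {A B : clopenAlgebra r e}
    (hA : A.1.Nonempty) (hA' : A.1ᶜ.Nonempty) (hB : B.1.Nonempty) (hB' : B.1ᶜ.Nonempty)
    (h : clopenSize A = clopenSize B) : ∃ g ∈ prefixGroup r e, g '' A.1 = B.1 := by
  obtain ⟨N, h₁, h₂⟩ := exists_common_hasBasis hn hA hB h
  obtain ⟨M, h₃, h₄⟩ := exists_common_hasBasis (A := Aᶜ) (B := Bᶜ) hn hA' hB' (by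
    have h₁ := clopenSize_compl hn A
    rw [h, ← clopenSize_compl hn B] at h₁
    exact add_left_cancel h₁)
  exact exists_image_eq_of_hasBasis h₁ h₂ h₃ h₄

end Size

/-! ### The derived group of the prefix replacement group is locally rich -/

section Rich

open scoped commutatorElement

variable {n r : ℕ} {C : Type} {e : Fin n × C ≃ C}

theorem commutator_prefixGroup_le : ⁅prefixGroup r e, prefixGroup r e⁆ ≤ prefixGroup r e :=
  Subgroup.commutator_le.2 fun _ hg _ hh =>
    mul_mem (mul_mem (mul_mem hg hh) (inv_mem hg)) (inv_mem hh)

theorem pow_coneMap_eq {f : Equiv.Perm (Fin r × C)} {u : HTPt n r} {w : List (Fin n)}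
    (h : ∀ c, f (coneMap e u c) = coneMap e (HTact u w) c) (k : ℕ) :
    ∃ w', w'.length = k * w.length ∧
      ∀ c, (f ^ k) (coneMap e u c) = coneMap e (HTact u w') c := by
  induction k with
  | zero => exact ⟨[], by simp, by simp⟩
  | succ k ih =>
    obtain ⟨w', hw', hk⟩ := ih
    refine ⟨w ++ w', by rw [List.length_append, hw']; ring, fun c => ?_⟩
    rw [pow_succ', Equiv.Perm.mul_apply, hk, coneMap_HTact, h, ← coneMap_HTact, HTact_HTact]

theorem not_isOfFinOrder_of_coneMap [Nonempty C] (hn : 2 ≤ n) {f : Equiv.Perm (Fin r × C)}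
    {u : HTPt n r} {w : List (Fin n)} (hw : w ≠ [])
    (h : ∀ c, f (coneMap e u c) = coneMap e (HTact u w) c) : ¬ IsOfFinOrder f := by
  intro hf
  obtain ⟨k, hk, hk1⟩ := isOfFinOrder_iff_pow_eq_one.1 hf
  obtain ⟨w', hw', h'⟩ := pow_coneMap_eq h k
  have hu : u = HTact u w' := eq_of_coneMap_eq e hn fun c => by rw [← h', hk1]; rfl
  have h₁ := congrArg (fun v : HTPt n r => v.2.length) hu
  simp only [length_HTact] at h₁
  have h₂ : 0 < k * w.length := Nat.mul_pos hk (List.length_pos_iff.2 hw)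
  omega

theorem moved_mem_clopenAlgebra [Nonempty C] (hn : 2 ≤ n) {f : Equiv.Perm (Fin r × C)}
    (hf : f ∈ prefixGroup r e) (hfin : IsOfFinOrder f) : moved f ∈ clopenAlgebra r e := by
  obtain ⟨K, hK⟩ := hf
  refine ⟨K, fun u hu c c' hc hc' => ?_⟩
  obtain ⟨v, hv⟩ := hK u hu
  have hne : u ≠ v := fun h => hc (by rw [hv, h])
  rw [hv] at hc'
  rcases le_total u.2.length v.2.length with hl | hl
  · obtain ⟨w, rfl, -⟩ := exists_HTact_of_coneMap_eq e hl hc'.symm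
    exact not_isOfFinOrder_of_coneMap hn (by rintro rfl; simp at hne) hv hfin
  · obtain ⟨w, rfl, -⟩ := exists_HTact_of_coneMap_eq e hl hc'
    refine not_isOfFinOrder_of_coneMap (e := e) (f := f⁻¹) hn (w := w) (u := v)
      (by rintro rfl; simp at hne) (fun c => ?_) hfin.inv
    rw [Equiv.Perm.inv_eq_iff_eq, hv]

theorem exists_disjoint_cone_of_list (hn : 2 ≤ n) (L : List (Equiv.Perm (Fin r × C)))
    (u : HTPt n r)
    (h : ∀ g ∈ L, ∃ v, u ≠ v ∧ ∀ c, g (coneMap e u c) = coneMap e v c) :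
    ∃ s, ∀ g ∈ L, ∃ v, (∀ c, g (coneMap e (HTact u s) c) = coneMap e v c) ∧
      Disjoint (cone e v) (cone e (HTact u s)) := by
  induction L generalizing u with
  | nil => exact ⟨[], by simp⟩
  | cons g L ih =>
    obtain ⟨v, hne, hv⟩ := h g (by simp)
    obtain ⟨s, hs⟩ := exists_disjoint_extension e hn hne
    obtain ⟨t, ht⟩ := ih (HTact u s) fun g' hg' => by
      obtain ⟨v', hne', hv'⟩ := h g' (by simp [hg'])
      refine ⟨HTact v' s, fun heq => hne' ?_, fun c => by rw [coneMap_HTact, hv', coneMap_HTact]⟩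
      simpa [HTact, Prod.ext_iff] using heq
    refine ⟨s ++ t, fun g' hg' => ?_⟩
    rw [← HTact_HTact]
    rcases List.mem_cons.1 hg' with rfl | hg'
    · refine ⟨HTact (HTact v s) t, fun c => ?_, ?_⟩
      · simp only [coneMap_HTact, hv]
      · exact hs.symm.mono (cone_HTact_subset e _ _) (cone_HTact_subset e _ _)
    · exact ht g' hg'

theorem exists_tameAt_of_list (L : List (Equiv.Perm (Fin r × C)))
    (h : ∀ g ∈ L, g ∈ prefixGroup r e) : ∃ K, ∀ g ∈ L, TameAt e K g := by
  induction L with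
  | nil => exact ⟨0, by simp⟩
  | cons g L ih =>
    obtain ⟨K, hK⟩ := ih fun g' hg' => h g' (by simp [hg'])
    obtain ⟨M, hM⟩ := h g (by simp)
    refine ⟨K + M, fun g' hg' => ?_⟩
    rcases List.mem_cons.1 hg' with rfl | hg'
    · exact hM.mono (Nat.le_add_left M K)
    · exact (hK g' hg').mono (Nat.le_add_right K M)

/-- Finitely many prefix replacements moving a point displace a common cone near that point. -/
theorem exists_displaced_cone (hn : 2 ≤ n) {A : Set (Fin r × C)} (hA : A ∈ clopenAlgebra r e)
    {x : Fin r × C} (hx : x ∈ A) (L : List (Equiv.Perm (Fin r × C)))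
    (h : ∀ g ∈ L, g ∈ prefixGroup r e ∧ g x ≠ x) :
    ∃ u, cone e u ⊆ A ∧ ∀ g ∈ L, ∃ v, (∀ c, g (coneMap e u c) = coneMap e v c) ∧
      Disjoint (cone e v) (cone e u) := by
  obtain ⟨K, hK⟩ := exists_tameAt_of_list L fun g hg => (h g hg).1
  obtain ⟨M, hM⟩ := hA
  obtain ⟨u, c, hu, rfl⟩ := exists_coneMap_eq e (K + M) x
  obtain ⟨s, hs⟩ := exists_disjoint_cone_of_list (e := e) hn L u fun g hg => by
    obtain ⟨v, hv⟩ := (hK g hg).of_le (u := u) (by omega)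
    exact ⟨v, fun huv => (h g hg).2 (by rw [hv, huv]), hv⟩
  refine ⟨HTact u s, ?_, hs⟩
  rintro _ ⟨c', rfl⟩
  rw [coneMap_HTact]
  exact hM.of_le (by omega) hx _

theorem exists_isBasis_subset (hn : 2 ≤ n) {A : Set (Fin r × C)} (hA : A ∈ clopenAlgebra r e)
    (hne : A.Nonempty) (k : ℕ) : ∃ b : Fin k → HTPt n r, ∃ B ⊆ A, IsBasis e b B := by
  obtain ⟨N, hN, b, hb⟩ := exists_hasBasis_ge hn hA hne k
  exact ⟨_, _, Set.iUnion_subset fun j => hb.cone_subset _,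
    hb.comp_injective (Fin.castLE_injective hN)⟩

theorem exists_moved_eq (hn : 2 ≤ n) {A : Set (Fin r × C)} (hA : A ∈ clopenAlgebra r e) :
    ∃ g ∈ ⁅prefixGroup r e, prefixGroup r e⁆, IsOfFinOrder g ∧ moved g = A := by
  rcases A.eq_empty_or_nonempty with rfl | hne
  · exact ⟨1, one_mem _, IsOfFinOrder.one, moved_one⟩
  obtain ⟨N, hN, b, hb⟩ := exists_hasBasis_ge hn hA hne 3
  obtain ⟨k, rfl⟩ := Nat.exists_eq_add_of_le' hN
  refine ⟨_, hb.permHom_commutator_mem (Equiv.addRight 1) (Equiv.neg _),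
    hb.permHom.isOfFinOrder (isOfFinOrder_of_finite _), ?_⟩
  have : moved ⁅Equiv.addRight (1 : Fin (k + 3)), Equiv.neg (Fin (k + 3))⁆ = Set.univ := by
    refine Set.eq_univ_of_forall fun j hj => ?_
    have h₁ : j + 1 + 1 = j := by
      simpa [commutatorElement_def, Equiv.Perm.inv_def, sub_eq_add_neg, add_comm] using hj
    rw [add_assoc, add_eq_left] at h₁
    have h₂ := congrArg Fin.val h₁
    simp only [Fin.val_add, Fin.val_one, Fin.val_zero] at h₂
    rw [Nat.mod_eq_of_lt (by omega)] at h₂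
    omega
  rw [hb.moved_permHom, this, ← hb.range_eq]
  ext x
  simp [basisMap, cone]

theorem isLocallyRich_commutator [Nonempty C] (hn : 2 ≤ n) :
    IsLocallyRich ⁅prefixGroup r e, prefixGroup r e⁆ (clopenAlgebra r e) where
  image_mem _ hg _ hA := image_mem_clopenAlgebra (commutator_prefixGroup_le hg) hA
  moved_mem _ hg hf := moved_mem_clopenAlgebra hn (commutator_prefixGroup_le hg) hf
  exists_moved _ hA := exists_moved_eq hn hA
  exists_displaced A hA x hx L hL := by
    obtain ⟨u, huA, hu⟩ := exists_displaced_cone hn hA hx L fun g hg =>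
      ⟨commutator_prefixGroup_le (hL g hg).1, (hL g hg).2⟩
    refine ⟨cone e u, cone_mem_clopenAlgebra u, cone_nonempty e u, huA, fun g hg => ?_⟩
    obtain ⟨v, hv, hd⟩ := hu g hg
    refine hd.mono_left ?_
    rintro _ ⟨_, ⟨c, rfl⟩, rfl⟩
    exact ⟨c, (hv c).symm⟩
  exists_not_commute U hU hne := by
    obtain ⟨b, B, hB, hb⟩ := exists_isBasis_subset hn hU hne 5
    refine ⟨_, hb.permHom_commutator_mem (Equiv.swap 0 1) (Equiv.swap 1 2), _,
      hb.permHom_commutator_mem (Equiv.swap 1 2) (Equiv.swap 2 3),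
      (hb.moved_permHom_subset _).trans hB, (hb.moved_permHom_subset _).trans hB, fun h => ?_⟩
    have := h.of_map hb.permHom_injective
    revert this
    unfold Commute SemiconjBy
    decide
  exists_pow_ne_one U hU hne := by
    obtain ⟨b, B, hB, hb⟩ := exists_isBasis_subset hn hU hne 5
    refine ⟨_, hb.permHom_commutator_mem (Equiv.addRight 1) (Equiv.neg _),
      (hb.moved_permHom_subset _).trans hB, fun h => ?_⟩
    rw [← map_pow, map_eq_one_iff _ hb.permHom_injective] at h
    revert h
    decide

/-! ### The derived group is transitive on clopen sets of equal size -/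

theorem exists_size_eq [Nonempty C] (hn : 2 ≤ n) {U : clopenAlgebra r e} (hU : U.1.Nonempty)
    (a : ZMod (n - 1)) :
    ∃ D : clopenAlgebra r e, D.1 ⊆ U.1 ∧ D.1.Nonempty ∧ (U.1 \ D.1).Nonempty ∧
      clopenSize D = a := by
  have : NeZero (n - 1) := ⟨by omega⟩
  obtain ⟨k, hk, hk1, hka⟩ : ∃ k, k < n ∧ 1 ≤ k ∧ (k : ZMod (n - 1)) = a := by
    refine ⟨(a - 1).val + 1, ?_, by omega, by simp⟩
    have := ZMod.val_lt (a - 1)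
    omega
  obtain ⟨x, hx⟩ := hU
  obtain ⟨u, -, -, hu⟩ := exists_cone_subset U.2 hx
  have hs := isBasis_split (e := e) u
  have hb := hs.comp_injective (Fin.castLE_injective hk.le)
  obtain ⟨c⟩ := ‹Nonempty C›
  refine ⟨⟨_, hb.mem_clopenAlgebra⟩, ?_, ?_, ?_, ?_⟩
  · exact Set.iUnion_subset fun j => (cone_HTact_subset e _ _).trans hu
  · exact ⟨_, Set.mem_iUnion.2 ⟨⟨0, hk1⟩, coneMap_mem_cone e _ c⟩⟩
  · refine ⟨coneMap e (HTact u [⟨k, hk⟩]) c,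
      hu (cone_HTact_subset e _ _ (coneMap_mem_cone e _ _)), fun h => ?_⟩
    obtain ⟨j, d, hd⟩ := Set.mem_iUnion.1 h
    have := congrArg (fun p => p.1.val) (@hs.injective (Fin.castLE hk.le j, d) (⟨k, hk⟩, c) hd)
    exact absurd this j.2.ne
  · rw [IsBasis.clopenSize_eq (by omega) hb, Nat.card_fin, hka]

theorem exists_mul_mem_commutator_of_moved_subset [Nonempty C] (hn : 2 ≤ n)
    {A : clopenAlgebra r e} (hA : A.1.Nonempty) {E : clopenAlgebra r e} (hE : E.1ᶜ.Nonempty)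
    {g : Equiv.Perm (Fin r × C)} (hg : g ∈ prefixGroup r e) (hgE : moved g ⊆ E.1) :
    ∃ h ∈ prefixGroup r e, moved h ⊆ A.1 ∧ g * h ∈ ⁅prefixGroup r e, prefixGroup r e⁆ := by
  rcases E.1.eq_empty_or_nonempty with hE0 | hE0
  · refine ⟨1, one_mem _, by simp, ?_⟩
    have : g = 1 := by
      by_contra hne
      obtain ⟨x, hx⟩ := moved_nonempty hne
      simpa [hE0] using hgE hx
    simp [this]
  obtain ⟨D, hDA, hD, ⟨y, hy⟩, hsize⟩ := exists_size_eq hn hA (clopenSize E)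
  obtain ⟨t, ht, htE⟩ := exists_image_eq_of_clopenSize_eq (by omega) hE0 hE hD ⟨y, hy.2⟩ hsize.symm
  refine ⟨t * g⁻¹ * t⁻¹, mul_mem (mul_mem ht (inv_mem hg)) (inv_mem ht), ?_, ?_⟩
  · rw [moved_conj, moved_inv]
    exact (Set.image_mono hgE).trans (htE.trans_subset hDA)
  · have : g * (t * g⁻¹ * t⁻¹) = ⁅g, t⁆ := by rw [commutatorElement_def]; group
    rw [this]
    exact Subgroup.commutator_mem_commutator hg ht

/-- A nontrivial prefix replacement is a product of two whose supports lie in proper clopen sets. -/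
theorem exists_eq_mul_of_moved [Nonempty C] (hn : 2 ≤ n) {g : Equiv.Perm (Fin r × C)}
    (hg : g ∈ prefixGroup r e) (hne : g ≠ 1) :
    ∃ g₁ ∈ prefixGroup r e, ∃ g₂ ∈ prefixGroup r e, ∃ E₁ E₂ : clopenAlgebra r e,
      g = g₁ * g₂ ∧ E₁.1ᶜ.Nonempty ∧ E₂.1ᶜ.Nonempty ∧ moved g₁ ⊆ E₁.1 ∧ moved g₂ ⊆ E₂.1 := by
  obtain ⟨x, hx⟩ := moved_nonempty hne
  obtain ⟨u, -, hu⟩ := exists_displaced_cone hn (⊤ : clopenAlgebra r e).2 (Set.mem_univ x) [g]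
    (by simpa using ⟨hg, hx⟩)
  obtain ⟨v, hv, hd⟩ := hu g (by simp)
  obtain ⟨c₀⟩ := ‹Nonempty C›
  let a : Fin n := ⟨0, by omega⟩
  let a' : Fin n := ⟨1, by omega⟩
  have hgc : ∀ c, g (coneMap e (HTact u [a]) c) = coneMap e (HTact v [a]) c := fun c => by
    rw [coneMap_HTact, hv, coneMap_HTact]
  have hb := (isBasis_cone (e := e) (HTact u [a])).sum (isBasis_cone (HTact v [a]))
    (hd.symm.mono (cone_HTact_subset e _ _) (cone_HTact_subset e _ _))
  set g₁ := hb.permHom (Equiv.sumComm _ _) with hg₁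
  have hg₁c : ∀ c, g₁ (coneMap e (HTact u [a]) c) = coneMap e (HTact v [a]) c :=
    hb.permHom_coneMap (Equiv.sumComm _ _) (.inl 0)
  have hT : g₁ ∈ prefixGroup r e := hb.permHom_mem _
  refine ⟨g₁, hT, g₁⁻¹ * g, mul_mem (inv_mem hT) hg, ⟨_, hb.mem_clopenAlgebra⟩,
    ⟨cone e (HTact u [a]), cone_mem_clopenAlgebra _⟩ᶜ, by group, ?_, ?_,
    hb.moved_permHom_subset _, ?_⟩
  · refine ⟨coneMap e (HTact u [a']) c₀, ?_⟩
    rintro (h | h)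
    · have hne' : HTact u [a'] ≠ HTact u [a] := fun h => by
        have := HTact_right_injective u h
        simp [a, a'] at this
      exact Set.disjoint_left.1 (disjoint_cone_of_length_eq e (by simp [length_HTact]) hne')
        (coneMap_mem_cone e _ _) h
    · exact Set.disjoint_left.1 hd (cone_HTact_subset e _ _ h)
        (cone_HTact_subset e _ _ (coneMap_mem_cone e _ c₀))
  · exact ⟨_, fun h => h (coneMap_mem_cone e _ c₀)⟩
  · rintro _ hy ⟨c, rfl⟩
    refine hy ?_
    rw [Equiv.Perm.mul_apply, Equiv.Perm.inv_eq_iff_eq, hgc, hg₁c]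

theorem exists_mul_mem_commutator [Nonempty C] (hn : 2 ≤ n) {A : clopenAlgebra r e}
    (hA : A.1.Nonempty) {g : Equiv.Perm (Fin r × C)} (hg : g ∈ prefixGroup r e) :
    ∃ h ∈ prefixGroup r e, moved h ⊆ A.1 ∧ g * h ∈ ⁅prefixGroup r e, prefixGroup r e⁆ := by
  by_cases hne : g = 1
  · exact ⟨1, one_mem _, by simp, by simp [hne]⟩
  obtain ⟨g₁, hg₁, g₂, hg₂, E₁, E₂, rfl, hE₁, hE₂, h₁, h₂⟩ := exists_eq_mul_of_moved hn hg hne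
  obtain ⟨k₁, hk₁, hk₁A, hm₁⟩ := exists_mul_mem_commutator_of_moved_subset hn hA hE₁ hg₁ h₁
  obtain ⟨k₂, hk₂, hk₂A, hm₂⟩ := exists_mul_mem_commutator_of_moved_subset hn hA hE₂ hg₂ h₂
  refine ⟨k₂ * k₁, mul_mem hk₂ hk₁, (moved_mul_subset _ _).trans (Set.union_subset hk₂A hk₁A), ?_⟩
  have hconj : g₁ * (g₂ * k₂) * g₁⁻¹ ∈ ⁅prefixGroup r e, prefixGroup r e⁆ := by
    have := mul_mem (Subgroup.commutator_mem_commutator hg₁ (commutator_prefixGroup_le hm₂)) hm₂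
    rwa [commutatorElement_def, inv_mul_cancel_right] at this
  have : g₁ * g₂ * (k₂ * k₁) = g₁ * (g₂ * k₂) * g₁⁻¹ * (g₁ * k₁) := by group
  rw [this]
  exact mul_mem hconj hm₁

theorem clopen_nonempty_iff {A : clopenAlgebra r e} : A.1.Nonempty ↔ A ≠ ⊥ := by
  rw [Set.nonempty_iff_ne_empty, Ne, Ne, Subtype.ext_iff]
  rfl

theorem isClassFunction_clopenSize [Nonempty C] (hn : 2 ≤ n) :
    IsClassFunction (isLocallyRich_commutator (r := r) (e := e) hn) clopenSize where
  map_sup _ _ h := clopenSize_sup (by omega) h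
  map_image g _ := clopenSize_eq_of_image (by omega) (commutator_prefixGroup_le g.2) rfl
  exists_image_eq A B hA hA' hB hB' h := by
    have hAc : A.1ᶜ.Nonempty := clopen_nonempty_iff (A := Aᶜ).2 (by rwa [Ne, compl_eq_bot])
    have hBc : B.1ᶜ.Nonempty := clopen_nonempty_iff (A := Bᶜ).2 (by rwa [Ne, compl_eq_bot])
    rw [← clopen_nonempty_iff] at hA hB
    obtain ⟨g, hg, hgA⟩ := exists_image_eq_of_clopenSize_eq (by omega) hA hAc hB hBc h
    obtain ⟨k, -, hkA, hgk⟩ := exists_mul_mem_commutator hn hAc (A := Aᶜ) hg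
    refine ⟨⟨g * k, hgk⟩, Subtype.ext ?_⟩
    change (g * k : Equiv.Perm (Fin r × C)) '' A.1 = B.1
    rw [← hgA]
    refine Set.image_congr fun x hx => ?_
    rw [Equiv.Perm.mul_apply, apply_eq_of_notMem_moved fun h => hkA h hx]
  exists_eq U hU a := by
    obtain ⟨D, hDU, hD, ⟨y, hy⟩, ha⟩ := exists_size_eq hn (clopen_nonempty_iff.2 hU) a
    exact ⟨D, hDU, clopen_nonempty_iff.1 hD, fun h => hy.2 (h ▸ hy.1), ha⟩

end Rich

/-! ### The invariants are determined by the derived group -/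

section Invariant

theorem nonempty_prod_nat_equiv {n : ℕ} (hn : 1 ≤ n) : Nonempty (Fin n × ℕ ≃ ℕ) := by
  have : Nonempty (Fin n) := ⟨⟨0, hn⟩⟩
  exact nonempty_equiv_of_countable

theorem nonempty_commutator_mulEquiv {G : Type*} [Group G] (H : Subgroup G) :
    Nonempty (commutator H ≃* (⁅H, H⁆ : Subgroup G)) :=
  ⟨((commutator H).equivMapOfInjective H.subtype H.subtype_injective).trans
    (MulEquiv.subgroupCongr H.map_subtype_commutator)⟩

theorem top_ne_bot_clopenAlgebra {n r : ℕ} {C : Type} [Nonempty C] {e : Fin n × C ≃ C}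
    (hr : 1 ≤ r) : (⊤ : clopenAlgebra r e) ≠ ⊥ := by
  obtain ⟨c⟩ := ‹Nonempty C›
  exact clopen_nonempty_iff.1 ⟨(⟨0, hr⟩, c), trivial⟩

theorem eq_and_gcd_eq_of_commutator_prefixGroup {m n r s : ℕ} {C : Type} [Nonempty C]
    {e : Fin m × C ≃ C} {e' : Fin n × C ≃ C} (hm : 2 ≤ m) (hn : 2 ≤ n) (hr : 1 ≤ r)
    (φ : (⁅prefixGroup r e, prefixGroup r e⁆ : Subgroup (Equiv.Perm (Fin r × C))) ≃*
      (⁅prefixGroup s e', prefixGroup s e'⁆ : Subgroup (Equiv.Perm (Fin s × C)))) :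
    m = n ∧ Nat.gcd (m - 1) r = Nat.gcd (n - 1) s := by
  have : NeZero (m - 1) := ⟨by omega⟩
  have : NeZero (n - 1) := ⟨by omega⟩
  obtain ⟨Φ, hΦ⟩ := (isLocallyRich_commutator hm).exists_orderIso (isLocallyRich_commutator hn) φ
  obtain ⟨ψ, hψ⟩ := (isClassFunction_clopenSize hm).exists_addEquiv
    (isClassFunction_clopenSize hn) (top_ne_bot_clopenAlgebra hr) φ hΦ
  rw [clopenSize_top (by omega), clopenSize_top (by omega)] at hψ
  obtain ⟨h₁, h₂⟩ := eq_and_gcd_eq_of_addEquiv ψ hψ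
  exact ⟨by omega, h₂⟩

theorem nonempty_commutator_HT_mulEquiv {n r : ℕ} {C : Type} [Nonempty C] (e : Fin n × C ≃ C)
    (hn : 2 ≤ n) (hr : 1 ≤ r) [Group (HT n r)] (hmul : IsHTMul n r (· * ·)) :
    Nonempty ((⁅prefixGroup r e, prefixGroup r e⁆ : Subgroup (Equiv.Perm (Fin r × C))) ≃*
      commutator (HT n r)) := by
  obtain ⟨f⟩ := nonempty_prefixGroup_mulEquiv e hn hr hmul
  obtain ⟨g⟩ := nonempty_commutator_mulEquiv (prefixGroup r e)
  obtain ⟨h⟩ := commutator_mulEquiv f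
  exact ⟨g.symm.trans h⟩

end Invariant

end HigmanThompson

/-- **The isomorphism problem for Higman–Thompson groups.**
The commutator subgroups `G⁺_{m,r}` and `G⁺_{n,s}` of the Higman–Thompson groups `G_{m,r}`
and `G_{n,s}` are isomorphic if and only if `m = n` and `gcd (m-1) r = gcd (n-1) s`.
The group structures on `G_{m,r}` and `G_{n,s}` are specified via the (unique) Higman–Thompson
multiplication: the product of two maximal cofinite isomorphisms extends their composite. -/
theorem higmanThompson_commutator_iso_iff (m n r s : ℕ) (hm : 2 ≤ m) (hn : 2 ≤ n)
    (hr : 1 ≤ r) (hs : 1 ≤ s)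
    [Group (HT m r)] [Group (HT n s)]
    (hmulr : IsHTMul m r (· * ·)) (hmuls : IsHTMul n s (· * ·)) :
    Nonempty ((commutator (HT m r)) ≃* (commutator (HT n s))) ↔
      (m = n ∧ Nat.gcd (m - 1) r = Nat.gcd (n - 1) s) := by
  constructor
  · rintro ⟨φ⟩
    obtain ⟨e⟩ := HigmanThompson.nonempty_prod_nat_equiv (n := m) (by omega)
    obtain ⟨e'⟩ := HigmanThompson.nonempty_prod_nat_equiv (n := n) (by omega)
    obtain ⟨f⟩ := HigmanThompson.nonempty_commutator_HT_mulEquiv e hm hr hmulr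
    obtain ⟨f'⟩ := HigmanThompson.nonempty_commutator_HT_mulEquiv e' hn hs hmuls
    exact HigmanThompson.eq_and_gcd_eq_of_commutator_prefixGroup hm hn hr
      ((f.trans φ).trans f'.symm)
  · rintro ⟨rfl, h⟩
    obtain ⟨f⟩ := HigmanThompson.nonempty_HT_mulEquiv hm hr hs hmulr hmuls h
    exact HigmanThompson.commutator_mulEquiv f
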